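/- arXiv:2408.01610 — 2 statements merged into one kernel-verified Lean document; each statement's English description precedes it below -/
import Mathlib

section
/- Let χ be a character of the ideal class group of K = ℚ(√−D), let 0 < α₁ < α₂ and let φ be a smooth function supported in [α₁, α₂], and let A > 0. Then there is a constant C depending only on φ and A such that for all x ≥ 2 and all integers 1 ≤ k ≤ x^{α₁}/D, one has | Σ_{ℓ≥1} (λ_χ(ℓ)/ℓ) φ(log(kℓ)/log x) − L(1, χ_D) φ̂(0) (log x) δ(χ) | ≤ C · D^{−1/2} (log x)^{−A}, where δ(χ) = 1 if χ is trivial and 0 otherwise, and φ̂(0) = ∫ φ(u) du. -/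
open NumberField
open scoped Classical

/-- The ideal class of a nonzero integral ideal (junk value `1` for the zero ideal). -/
noncomputable def idealClass (K : Type) [Field K] [NumberField K] (I : Ideal (𝓞 K)) :
    ClassGroup (𝓞 K) :=
  if h : I ∈ nonZeroDivisors (Ideal (𝓞 K)) then ClassGroup.mk0 ⟨I, h⟩ else 1

/-- `lambdaChi K χ n = Σ_{N𝔞 = n} χ(𝔞)`, the sum over integral ideals of norm `n`. -/
noncomputable def lambdaChi (K : Type) [Field K] [NumberField K]
    (χ : ClassGroup (𝓞 K) →* ℂ) (n : ℕ) : ℂ :=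
  ∑ᶠ I ∈ {I : Ideal (𝓞 K) | Ideal.absNorm I = n ∧ I ≠ 0}, χ (idealClass K I)

/-- The Kronecker symbol χ_D(n) = (−D/n), as the quadratic Dirichlet character mod `D`
(for prime `D ≡ 3 (mod 4)` this is the Legendre symbol character mod `D`). -/
noncomputable def chiD (D : ℕ) [Fact (Nat.Prime D)] : DirichletCharacter ℂ D :=
  (quadraticChar (ZMod D)).ringHomComp (Int.castRingHom ℂ)

section Analysis

open MeasureTheory

/-- The function `t ↦ t⁻ᵐ ψ((log t + κ) / X)` on `t > 0`, extended by zero. -/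
noncomputable def logBump (m : ℕ) (ψ : ℝ → ℝ) (X κ t : ℝ) : ℝ :=
  if 0 < t then ψ ((Real.log t + κ) / X) / t ^ m else 0

section logBump

variable {α₁ α₂ : ℝ} {ψ : ℝ → ℝ} {X κ : ℝ} {m : ℕ}

theorem logBump_of_pos {t : ℝ} (ht : 0 < t) :
    logBump m ψ X κ t = ψ ((Real.log t + κ) / X) / t ^ m := if_pos ht

theorem logBump_of_nonpos {t : ℝ} (ht : t ≤ 0) : logBump m ψ X κ t = 0 := if_neg ht.not_gt

theorem mul_logBump_succ (t : ℝ) : t * logBump (m + 1) ψ X κ t = logBump m ψ X κ t := by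
  rcases lt_or_ge 0 t with ht | ht
  · rw [logBump_of_pos ht, logBump_of_pos ht]
    field_simp
    ring
  · simp [logBump_of_nonpos ht]

theorem logBump_eq_zero_of_lt (hψ : Function.support ψ ⊆ Set.Icc α₁ α₂) (hX : 0 < X) {t : ℝ}
    (ht : t < Real.exp (X * α₁ - κ)) : logBump m ψ X κ t = 0 := by
  rcases lt_or_ge 0 t with h | h
  · rw [logBump_of_pos h]
    have : ψ ((Real.log t + κ) / X) = 0 := by
      by_contra hne
      have h1 := (hψ hne).1
      rw [le_div_iff₀ hX] at h1
      have := (Real.log_lt_iff_lt_exp h).2 ht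
      linarith
    simp [this]
  · exact logBump_of_nonpos h

theorem logBump_eq_zero_of_gt (hψ : Function.support ψ ⊆ Set.Icc α₁ α₂) (hX : 0 < X) {t : ℝ}
    (ht : Real.exp (X * α₂ - κ) < t) : logBump m ψ X κ t = 0 := by
  have h : 0 < t := (Real.exp_pos _).trans ht
  rw [logBump_of_pos h]
  have : ψ ((Real.log t + κ) / X) = 0 := by
    by_contra hne
    have h1 := (hψ hne).2
    rw [div_le_iff₀ hX] at h1
    have := (Real.lt_log_iff_exp_lt h).2 ht
    linarith
  simp [this]

theorem logBump_eventuallyEq_zero (hψ : Function.support ψ ⊆ Set.Icc α₁ α₂) (hX : 0 < X) {t : ℝ}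
    (ht : t ≤ 0) : logBump m ψ X κ =ᶠ[nhds t] fun _ ↦ 0 := by
  filter_upwards [eventually_lt_nhds (ht.trans_lt (Real.exp_pos (X * α₁ - κ)))] with u hu
  exact logBump_eq_zero_of_lt hψ hX hu

theorem logBump_eventuallyEq {t : ℝ} (ht : 0 < t) :
    logBump m ψ X κ =ᶠ[nhds t] fun t ↦ ψ ((Real.log t + κ) / X) / t ^ m := by
  filter_upwards [eventually_gt_nhds ht] with u hu
  exact logBump_of_pos hu

theorem contDiff_logBump (hψ : Function.support ψ ⊆ Set.Icc α₁ α₂) (hX : 0 < X)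
    {n : ℕ∞} (hs : ContDiff ℝ n ψ) : ContDiff ℝ n (logBump m ψ X κ) := by
  rw [contDiff_iff_contDiffAt]
  intro t
  rcases lt_or_ge 0 t with ht | ht
  · refine ContDiffAt.congr_of_eventuallyEq ?_ (logBump_eventuallyEq ht)
    have h1 : ContDiffAt ℝ n (fun t ↦ (Real.log t + κ) / X) t :=
      ((Real.contDiffAt_log.2 ht.ne').add contDiffAt_const).div_const _
    exact (hs.contDiffAt.comp t h1).div (contDiffAt_id.pow m) (pow_ne_zero _ ht.ne')
  · exact contDiffAt_const.congr_of_eventuallyEq (logBump_eventuallyEq_zero hψ hX ht)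

theorem hasCompactSupport_logBump (hψ : Function.support ψ ⊆ Set.Icc α₁ α₂) (hX : 0 < X) :
    HasCompactSupport (logBump m ψ X κ) := by
  refine HasCompactSupport.intro (isCompact_Icc
    (a := Real.exp (X * α₁ - κ)) (b := Real.exp (X * α₂ - κ))) fun t ht ↦ ?_
  by_cases h : t < Real.exp (X * α₁ - κ)
  · exact logBump_eq_zero_of_lt hψ hX h
  · refine logBump_eq_zero_of_gt hψ hX ?_
    by_contra h'
    exact ht ⟨not_lt.1 h, not_lt.1 h'⟩

theorem support_deriv_subset_Icc (hψ : Function.support ψ ⊆ Set.Icc α₁ α₂) :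
    Function.support (deriv ψ) ⊆ Set.Icc α₁ α₂ :=
  support_deriv_subset.trans (closure_minimal hψ isClosed_Icc)

theorem hasDerivAt_logBump (hψ : Function.support ψ ⊆ Set.Icc α₁ α₂) (hX : 0 < X)
    (hs : Differentiable ℝ ψ) (t : ℝ) :
    HasDerivAt (logBump m ψ X κ)
      (X⁻¹ * logBump (m + 1) (deriv ψ) X κ t - m * logBump (m + 1) ψ X κ t) t := by
  rcases lt_or_ge 0 t with ht | ht
  · refine HasDerivAt.congr_of_eventuallyEq ?_ (logBump_eventuallyEq ht)
    rw [logBump_of_pos ht, logBump_of_pos ht]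
    have h1 : HasDerivAt (fun t ↦ (Real.log t + κ) / X) (t⁻¹ / X) t :=
      ((Real.hasDerivAt_log ht.ne').add_const κ).div_const X
    have h2 := ((hs ((Real.log t + κ) / X)).hasDerivAt.comp t h1).div (hasDerivAt_pow m t)
      (pow_ne_zero _ ht.ne')
    refine h2.congr_deriv ?_
    rcases m with _ | m
    · simp
      field_simp
    · simp only [Function.comp, Nat.add_sub_cancel]
      field_simp
      ring
  · rw [logBump_of_nonpos ht, logBump_of_nonpos ht]
    simpa using (hasDerivAt_const t (0 : ℝ)).congr_of_eventuallyEq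
      (logBump_eventuallyEq_zero hψ hX ht)

end logBump

/-- The plane wave `w ↦ exp(-2πi⟨w, ξ⟩)` on `ℂ ≅ ℝ²`. -/
noncomputable def planeWave (ξ w : ℂ) : ℂ :=
  Complex.exp (((-2 * Real.pi * inner ℝ w ξ : ℝ) : ℂ) * Complex.I)

theorem norm_planeWave (ξ w : ℂ) : ‖planeWave ξ w‖ = 1 := Complex.norm_exp_ofReal_mul_I _

@[fun_prop]
theorem continuous_planeWave (ξ : ℂ) : Continuous (planeWave ξ) := by
  unfold planeWave
  fun_prop

theorem hasLineDerivAt_planeWave (ξ v w : ℂ) :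
    HasLineDerivAt ℝ (planeWave ξ)
      (((-2 * Real.pi * inner ℝ v ξ : ℝ) : ℂ) * Complex.I * planeWave ξ w) w v := by
  unfold HasLineDerivAt planeWave
  have h1 : HasDerivAt (fun t : ℝ ↦ -2 * Real.pi * inner ℝ (w + t • v) ξ)
      (-2 * Real.pi * inner ℝ v ξ) 0 := by
    have : (fun t : ℝ ↦ -2 * Real.pi * inner ℝ (w + t • v) ξ) =
        fun t : ℝ ↦ -2 * Real.pi * inner ℝ w ξ + t * (-2 * Real.pi * inner ℝ v ξ) := by
      ext t
      rw [inner_add_left, real_inner_smul_left]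
      ring
    rw [this]
    simpa using ((hasDerivAt_id (0 : ℝ)).mul_const (-2 * Real.pi * inner ℝ v ξ)).const_add
      (-2 * Real.pi * inner ℝ w ξ)
  have h2 := (h1.ofReal_comp.mul_const Complex.I).cexp
  simp only [zero_smul, add_zero] at h2
  refine h2.congr_deriv ?_
  ring

theorem integral_hasLineDerivAt_mul_planeWave {G G' : ℂ → ℂ} {v : ℂ} (ξ : ℂ)
    (hG : Continuous G) (hG' : Continuous G') (hs : HasCompactSupport G)
    (hs' : HasCompactSupport G') (hd : ∀ w, HasLineDerivAt ℝ G (G' w) w v) :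
    ∫ w, G' w * planeWave ξ w =
      -(((-2 * Real.pi * inner ℝ v ξ : ℝ) : ℂ) * Complex.I) * ∫ w, G w * planeWave ξ w := by
  have key := integral_bilinear_hasLineDerivAt_right_eq_neg_left_of_integrable
    (μ := (volume : Measure ℂ)) (f := G) (f' := G') (g := planeWave ξ)
    (g' := fun w ↦ ((-2 * Real.pi * inner ℝ v ξ : ℝ) : ℂ) * Complex.I * planeWave ξ w) (v := v)
    (B := ContinuousLinearMap.mul ℝ ℂ)
    ((hG'.mul (continuous_planeWave ξ)).integrable_of_hasCompactSupport hs'.mul_right)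
    ((hG.mul (continuous_const.mul (continuous_planeWave ξ))).integrable_of_hasCompactSupport
      hs.mul_right)
    ((hG.mul (continuous_planeWave ξ)).integrable_of_hasCompactSupport hs.mul_right)
    (fun w _ ↦ hd w) (fun w _ ↦ hasLineDerivAt_planeWave ξ v w)
  simp only [ContinuousLinearMap.mul_apply'] at key
  rw [← neg_eq_iff_eq_neg] at key
  rw [← key, ← integral_const_mul, ← integral_neg]
  congr 1
  ext w
  ring

theorem hasDerivAt_norm_sq_line (v w : ℂ) :
    HasDerivAt (fun t : ℝ ↦ ‖w + t • v‖ ^ 2) (2 * inner ℝ w v) 0 := by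
  have h : HasDerivAt (fun t : ℝ ↦ w + t • v) v 0 := by
    simpa using ((hasDerivAt_id (0 : ℝ)).smul_const v).const_add w
  simpa using h.norm_sq

theorem hasCompactSupport_comp_norm_sq {p : ℝ → ℝ} (hs : HasCompactSupport p) :
    HasCompactSupport fun w : ℂ ↦ p (‖w‖ ^ 2) := by
  obtain ⟨R, hR⟩ := hs.isCompact.isBounded.subset_closedBall 0
  refine HasCompactSupport.intro (isCompact_closedBall (0 : ℂ) (1 + |R|)) fun w hw ↦ ?_
  by_contra hne
  have h1 := hR (subset_tsupport p hne)
  rw [Metric.mem_closedBall, dist_zero_right, Real.norm_of_nonneg (by positivity)] at h1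
  rw [Metric.mem_closedBall, dist_zero_right, not_le] at hw
  nlinarith [abs_nonneg R, le_abs_self R]

/-- The Fourier transform on `ℂ` intertwines the radial Laplacian with multiplication by
`-4π²‖ξ‖²`. -/
theorem integral_radial_laplacian_mul_planeWave {p p₁ p₂ : ℝ → ℝ}
    (h₁ : ∀ t, HasDerivAt p (p₁ t) t) (h₂ : ∀ t, HasDerivAt p₁ (p₂ t) t) (hc : Continuous p₂)
    (hs : HasCompactSupport p) (ξ : ℂ) :
    ∫ w : ℂ, ((4 * (‖w‖ ^ 2 * p₂ (‖w‖ ^ 2) + p₁ (‖w‖ ^ 2)) : ℝ) : ℂ) * planeWave ξ w =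
      -((4 * Real.pi ^ 2 * ‖ξ‖ ^ 2 : ℝ) : ℂ) * ∫ w : ℂ, (p (‖w‖ ^ 2) : ℂ) * planeWave ξ w := by
  have hp₁ : p₁ = deriv p := funext fun t ↦ (h₁ t).deriv.symm
  have hp₂ : p₂ = deriv p₁ := funext fun t ↦ (h₂ t).deriv.symm
  have hs₁ : HasCompactSupport p₁ := hp₁ ▸ hs.deriv
  have hs₂ : HasCompactSupport p₂ := hp₂ ▸ hs₁.deriv
  have hpc : Continuous p := continuous_iff_continuousAt.2 fun t ↦ (h₁ t).continuousAt
  have hpc₁ : Continuous p₁ := continuous_iff_continuousAt.2 fun t ↦ (h₂ t).continuousAt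
  have ofR {f : ℂ → ℝ} (hf : HasCompactSupport f) : HasCompactSupport fun w ↦ (f w : ℂ) :=
    hf.comp_left (g := fun r : ℝ ↦ (r : ℂ)) Complex.ofReal_zero
  have S₀ := hasCompactSupport_comp_norm_sq hs
  have S₁ := hasCompactSupport_comp_norm_sq hs₁
  have S₂ := hasCompactSupport_comp_norm_sq hs₂
  have dir (v : ℂ) : ∫ w : ℂ, ((2 * ‖v‖ ^ 2 * p₁ (‖w‖ ^ 2) +
      (2 * inner ℝ w v) ^ 2 * p₂ (‖w‖ ^ 2) : ℝ) : ℂ) * planeWave ξ w =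
      -((4 * Real.pi ^ 2 * (inner ℝ v ξ) ^ 2 : ℝ) : ℂ) *
        ∫ w : ℂ, (p (‖w‖ ^ 2) : ℂ) * planeWave ξ w := by
    have S₁' : HasCompactSupport fun w : ℂ ↦ 2 * inner ℝ w v * p₁ (‖w‖ ^ 2) := S₁.mul_left
    have d₀ (w : ℂ) : HasLineDerivAt ℝ (fun w : ℂ ↦ (p (‖w‖ ^ 2) : ℂ))
        ((2 * inner ℝ w v * p₁ (‖w‖ ^ 2) : ℝ) : ℂ) w v := by
      unfold HasLineDerivAt
      have := (h₁ (‖w‖ ^ 2)).comp_of_eq (0 : ℝ) (hasDerivAt_norm_sq_line v w) (by simp)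
      exact (this.congr_deriv (mul_comm _ _)).ofReal_comp
    have d₁ (w : ℂ) : HasLineDerivAt ℝ (fun w : ℂ ↦ ((2 * inner ℝ w v * p₁ (‖w‖ ^ 2) : ℝ) : ℂ))
        ((2 * ‖v‖ ^ 2 * p₁ (‖w‖ ^ 2) + (2 * inner ℝ w v) ^ 2 * p₂ (‖w‖ ^ 2) : ℝ) : ℂ) w v := by
      unfold HasLineDerivAt
      have e1 := (h₂ (‖w‖ ^ 2)).comp_of_eq (0 : ℝ) (hasDerivAt_norm_sq_line v w) (by simp)
      have e2 : HasDerivAt (fun t : ℝ ↦ 2 * inner ℝ (w + t • v) v) (2 * ‖v‖ ^ 2) 0 := by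
        have : (fun t : ℝ ↦ 2 * inner ℝ (w + t • v) v) =
            fun t : ℝ ↦ 2 * inner ℝ w v + t * (2 * ‖v‖ ^ 2) := by
          ext t
          rw [inner_add_left, real_inner_smul_left, real_inner_self_eq_norm_sq]
          ring
        rw [this]
        simpa using ((hasDerivAt_id (0 : ℝ)).mul_const (2 * ‖v‖ ^ 2)).const_add (2 * inner ℝ w v)
      refine HasDerivAt.ofReal_comp (((e2.mul e1).congr_deriv ?_))
      simp
      ring
    have S₂' : HasCompactSupport fun w : ℂ ↦ 2 * ‖v‖ ^ 2 * p₁ (‖w‖ ^ 2) +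
        (2 * inner ℝ w v) ^ 2 * p₂ (‖w‖ ^ 2) := S₁.mul_left.add S₂.mul_left
    rw [integral_hasLineDerivAt_mul_planeWave ξ (v := v) (by fun_prop) (by fun_prop) (ofR S₁')
      (ofR S₂') d₁,
      integral_hasLineDerivAt_mul_planeWave ξ (v := v) (by fun_prop) (by fun_prop) (ofR S₀)
        (ofR S₁') d₀]
    push_cast
    ring_nf
    rw [Complex.I_sq]
    ring
  have h := congrArg₂ (· + ·) (dir 1) (dir Complex.I)
  rw [← integral_add, ← add_mul] at h
  · convert h using 1
    · congr 1
      ext w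
      rw [← add_mul]
      congr 1
      rw [← Complex.ofReal_add]
      congr 1
      simp only [Complex.inner, norm_one, Complex.norm_I, Complex.mul_re, Complex.one_re,
        Complex.one_im, Complex.conj_re, Complex.conj_im, Complex.I_re, Complex.I_im,
        Complex.sq_norm, Complex.normSq_apply]
      ring
    · congr 1
      rw [← neg_add, ← Complex.ofReal_add]
      congr 2
      simp only [Complex.inner, Complex.mul_re, Complex.one_re,
        Complex.one_im, Complex.conj_re, Complex.conj_im, Complex.I_re, Complex.I_im,
        Complex.sq_norm, Complex.normSq_apply]
      ring
  all_goals
    refine Continuous.integrable_of_hasCompactSupport (by fun_prop) (HasCompactSupport.mul_right ?_)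
    exact ofR (S₁.mul_left.add S₂.mul_left)

theorem exists_abs_le_mul_pow_of_support_subset {α₁ α₂ : ℝ} (M : ℕ) :
    ∀ ψ : ℝ → ℝ, ContDiff ℝ (⊤ : ℕ∞) ψ → Function.support ψ ⊆ Set.Icc α₁ α₂ →
      ∃ C : ℝ, 0 ≤ C ∧ ∀ u, α₁ ≤ u → |ψ u| ≤ C * (u - α₁) ^ M := by
  induction M with
  | zero =>
    intro ψ hs hψ
    have hc : HasCompactSupport ψ := HasCompactSupport.of_support_subset_isCompact isCompact_Icc hψ
    obtain ⟨C, hC⟩ := hc.exists_bound_of_continuous hs.continuous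
    exact ⟨C, (norm_nonneg _).trans (hC 0), fun u _ ↦ by simpa using hC u⟩
  | succ M ih =>
    intro ψ hs hψ
    obtain ⟨C, hC0, hC⟩ := ih (deriv ψ) (contDiff_infty_iff_deriv.1 hs).2
      (support_deriv_subset_Icc hψ)
    refine ⟨C, hC0, fun u hu ↦ ?_⟩
    have hα : ψ α₁ = 0 := by
      have h1 : Set.EqOn ψ (fun _ ↦ 0) (Set.Iio α₁) := fun v hv ↦ by
        by_contra hne
        exact (hψ hne).1.not_gt hv
      have h2 := h1.closure hs.continuous continuous_const
      rw [closure_Iio] at h2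
      exact h2 (Set.mem_Iic.2 le_rfl)
    have := Convex.norm_image_sub_le_of_norm_deriv_le (f := ψ) (C := C * (u - α₁) ^ M)
      (s := Set.Icc α₁ u) (x := α₁) (y := u)
      (fun v _ ↦ (hs.differentiable (by simp)).differentiableAt)
      (fun v hv ↦ (hC v hv.1).trans (by
        have := hv.1
        have := hv.2
        gcongr)) (convex_Icc _ _) ⟨le_rfl, hu⟩ ⟨hu, le_rfl⟩
    rw [hα, sub_zero, Real.norm_eq_abs, Real.norm_of_nonneg (sub_nonneg.2 hu)] at this
    rw [pow_succ, ← mul_assoc]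
    exact this

/-- The flatness of `ψ` at the left end of its support turns into a saving of `X⁻ᴹ`. -/
theorem exists_abs_logBump_le {α₁ α₂ : ℝ} (n M : ℕ) {ψ : ℝ → ℝ} (hs : ContDiff ℝ (⊤ : ℕ∞) ψ)
    (hψ : Function.support ψ ⊆ Set.Icc α₁ α₂) :
    ∃ C : ℝ, 0 ≤ C ∧ ∀ X κ s t : ℝ, 0 < X → 0 < s → s ≤ Real.exp (X * α₁ - κ) → 0 ≤ t →
      |logBump (n + 1) ψ X κ t| ≤ C * (X ^ M)⁻¹ * s⁻¹ * ((s + t) ^ n)⁻¹ := by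
  obtain ⟨C, hC0, hC⟩ := exists_abs_le_mul_pow_of_support_subset M ψ hs hψ
  refine ⟨C * M.factorial * 2 ^ n, by positivity, fun X κ s t hX hs0 hst ht ↦ ?_⟩
  by_cases h : t < Real.exp (X * α₁ - κ)
  · rw [logBump_eq_zero_of_lt hψ hX h, abs_zero]
    positivity
  rw [not_lt] at h
  have ht0 : 0 < t := (Real.exp_pos _).trans_le h
  have hlog : X * α₁ - κ ≤ Real.log t := (Real.le_log_iff_exp_le ht0).2 h
  set u := (Real.log t + κ) / X with hu
  have hXu : X * u = Real.log t + κ := by rw [hu]; field_simp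
  have hau : α₁ ≤ u := by rw [hu, le_div_iff₀ hX]; linarith
  have h1 : (u - α₁) ^ M ≤ M.factorial * (X ^ M)⁻¹ * (t * s⁻¹) := by
    have e1 := Real.pow_div_factorial_le_exp (X * (u - α₁))
      (mul_nonneg hX.le (sub_nonneg.2 hau)) M
    have e2 : Real.exp (X * (u - α₁)) ≤ t * s⁻¹ := by
      have : X * (u - α₁) = Real.log t - (X * α₁ - κ) := by rw [mul_sub, hXu]; ring
      rw [this, Real.exp_sub, Real.exp_log ht0, div_eq_mul_inv]
      gcongr
    rw [div_le_iff₀ (by positivity), mul_pow] at e1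
    calc (u - α₁) ^ M = (X ^ M)⁻¹ * (X ^ M * (u - α₁) ^ M) := by field_simp
      _ ≤ (X ^ M)⁻¹ * (Real.exp (X * (u - α₁)) * M.factorial) := by gcongr
      _ ≤ (X ^ M)⁻¹ * ((t * s⁻¹) * M.factorial) := by gcongr
      _ = _ := by ring
  rw [logBump_of_pos ht0, ← hu, abs_div, abs_of_pos (pow_pos ht0 _), div_le_iff₀ (pow_pos ht0 _)]
  have h2 : (s + t) ^ n ≤ 2 ^ n * t ^ n := by
    rw [← mul_pow]
    gcongr
    linarith
  calc |ψ u| ≤ C * (u - α₁) ^ M := hC u hau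
    _ ≤ C * (M.factorial * (X ^ M)⁻¹ * (t * s⁻¹)) := by gcongr
    _ = C * M.factorial * (X ^ M)⁻¹ * s⁻¹ * t * (((s + t) ^ n)⁻¹ * (s + t) ^ n) := by
      rw [inv_mul_cancel₀ (by positivity)]; ring
    _ ≤ C * M.factorial * (X ^ M)⁻¹ * s⁻¹ * t * (((s + t) ^ n)⁻¹ * (2 ^ n * t ^ n)) := by gcongr
    _ = _ := by ring

theorem integrable_inv_add_norm_sq_pow {n : ℕ} (hn : 2 ≤ n) {s : ℝ} (hs : 0 < s) :
    Integrable fun w : ℂ ↦ ((s + ‖w‖ ^ 2) ^ n)⁻¹ := by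
  have h := integrable_rpow_neg_one_add_norm_sq (E := ℂ) (μ := volume) (r := 2 * n) (by
    rw [Complex.finrank_real_complex]
    norm_cast
    omega)
  have h1 : Integrable fun w : ℂ ↦ ((1 + ‖w‖ ^ 2) ^ n)⁻¹ := by
    refine h.congr (Filter.Eventually.of_forall fun w ↦ ?_)
    simp only
    rw [neg_div, mul_div_cancel_left₀ _ two_ne_zero, Real.rpow_neg (by positivity),
      Real.rpow_natCast]
  have h2 := (h1.comp_smul (R := (Real.sqrt s)⁻¹) (by positivity)).const_mul ((s ^ n)⁻¹)
  refine h2.congr (Filter.Eventually.of_forall fun w ↦ ?_)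
  simp only [norm_smul, norm_inv, Real.norm_of_nonneg (Real.sqrt_nonneg s), mul_pow, inv_pow,
    Real.sq_sqrt hs.le]
  rw [← mul_inv, ← mul_pow]
  congr 2
  field_simp

theorem integral_inv_add_norm_sq_pow (n : ℕ) {s : ℝ} (hs : 0 < s) :
    ∫ w : ℂ, ((s + ‖w‖ ^ 2) ^ n)⁻¹ = s * (s ^ n)⁻¹ * ∫ w : ℂ, ((1 + ‖w‖ ^ 2) ^ n)⁻¹ := by
  have h := Measure.integral_comp_smul (volume : Measure ℂ)
    (fun w : ℂ ↦ ((s + ‖w‖ ^ 2) ^ n)⁻¹) (Real.sqrt s)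
  rw [Complex.finrank_real_complex, Real.sq_sqrt hs.le, abs_of_pos (inv_pos.2 hs), smul_eq_mul]
    at h
  simp only [norm_smul, Real.norm_of_nonneg (Real.sqrt_nonneg s), mul_pow, Real.sq_sqrt hs.le] at h
  have h' (w : ℂ) : ((s + s * ‖w‖ ^ 2) ^ n)⁻¹ = (s ^ n)⁻¹ * ((1 + ‖w‖ ^ 2) ^ n)⁻¹ := by
    rw [← mul_inv, ← mul_pow]
    congr 2
    ring
  simp only [h'] at h
  rw [integral_const_mul] at h
  rw [mul_assoc, h]
  field_simp

/-- The Fourier transform of `w ↦ logBump m ψ X κ (‖w‖²)` on `ℂ`. -/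
noncomputable def radialFourier (m : ℕ) (ψ : ℝ → ℝ) (X κ : ℝ) (ξ : ℂ) : ℂ :=
  ∫ w : ℂ, (logBump m ψ X κ (‖w‖ ^ 2) : ℂ) * planeWave ξ w

theorem integrable_logBump_mul_planeWave {α₁ α₂ : ℝ} {ψ : ℝ → ℝ}
    (hs : ContDiff ℝ (⊤ : ℕ∞) ψ) (hψ : Function.support ψ ⊆ Set.Icc α₁ α₂) (m : ℕ) {X : ℝ} (κ : ℝ)
    (hX : 0 < X) (ξ : ℂ) :
    Integrable fun w : ℂ ↦ (logBump m ψ X κ (‖w‖ ^ 2) : ℂ) * planeWave ξ w := by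
  have h1 : Continuous (logBump m ψ X κ) := (contDiff_logBump hψ hX hs).continuous
  refine Continuous.integrable_of_hasCompactSupport (by fun_prop) (HasCompactSupport.mul_right ?_)
  exact (hasCompactSupport_comp_norm_sq (hasCompactSupport_logBump hψ hX)).comp_left
    (g := fun r : ℝ ↦ (r : ℂ)) Complex.ofReal_zero

theorem norm_sq_mul_radialFourier {α₁ α₂ : ℝ} {ψ : ℝ → ℝ} (hs : ContDiff ℝ (⊤ : ℕ∞) ψ)
    (hψ : Function.support ψ ⊆ Set.Icc α₁ α₂) (m : ℕ) {X : ℝ} (κ : ℝ) (hX : 0 < X) (ξ : ℂ) :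
    ((Real.pi ^ 2 * ‖ξ‖ ^ 2 : ℝ) : ℂ) * radialFourier m ψ X κ ξ =
      -((X⁻¹ ^ 2 : ℝ) * radialFourier (m + 1) (deriv (deriv ψ)) X κ ξ -
        (2 * m * X⁻¹ : ℝ) * radialFourier (m + 1) (deriv ψ) X κ ξ +
        (m ^ 2 : ℝ) * radialFourier (m + 1) ψ X κ ξ) := by
  have hs₁ := (contDiff_infty_iff_deriv.1 hs)
  have hs₂ := (contDiff_infty_iff_deriv.1 hs₁.2)
  have hψ₁ := support_deriv_subset_Icc hψ
  have hψ₂ := support_deriv_subset_Icc hψ₁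
  have key := integral_radial_laplacian_mul_planeWave
    (p := logBump m ψ X κ) (hasDerivAt_logBump hψ hX hs₁.1)
    (fun t ↦ ((hasDerivAt_logBump (m := m + 1) (κ := κ) hψ₁ hX hs₂.1 t).const_mul X⁻¹).sub
      ((hasDerivAt_logBump (m := m + 1) (κ := κ) hψ hX hs₁.1 t).const_mul (m : ℝ)))
    (by
      have c₀ : Continuous (logBump (m + 1 + 1) ψ X κ) := (contDiff_logBump hψ hX hs).continuous
      have c₁ : Continuous (logBump (m + 1 + 1) (deriv ψ) X κ) :=
        (contDiff_logBump hψ₁ hX hs₁.2).continuous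
      have c₂ : Continuous (logBump (m + 1 + 1) (deriv (deriv ψ)) X κ) :=
        (contDiff_logBump hψ₂ hX hs₂.2).continuous
      fun_prop)
    (hasCompactSupport_logBump hψ hX) ξ
  have I₀ := integrable_logBump_mul_planeWave hs hψ (m + 1) κ hX ξ
  have I₁ := integrable_logBump_mul_planeWave hs₁.2 hψ₁ (m + 1) κ hX ξ
  have I₂ := integrable_logBump_mul_planeWave hs₂.2 hψ₂ (m + 1) κ hX ξ
  have e : ∀ w : ℂ, ((4 * (‖w‖ ^ 2 *
      (X⁻¹ * (X⁻¹ * logBump (m + 1 + 1) (deriv (deriv ψ)) X κ (‖w‖ ^ 2) -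
          ((m + 1 : ℕ) : ℝ) * logBump (m + 1 + 1) (deriv ψ) X κ (‖w‖ ^ 2)) -
        m * (X⁻¹ * logBump (m + 1 + 1) (deriv ψ) X κ (‖w‖ ^ 2) -
          ((m + 1 : ℕ) : ℝ) * logBump (m + 1 + 1) ψ X κ (‖w‖ ^ 2))) +
      (X⁻¹ * logBump (m + 1) (deriv ψ) X κ (‖w‖ ^ 2) -
        m * logBump (m + 1) ψ X κ (‖w‖ ^ 2))) : ℝ) : ℂ) * planeWave ξ w =
      (4 * X⁻¹ ^ 2 : ℝ) * ((logBump (m + 1) (deriv (deriv ψ)) X κ (‖w‖ ^ 2) : ℂ) *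
        planeWave ξ w) - (8 * m * X⁻¹ : ℝ) * ((logBump (m + 1) (deriv ψ) X κ (‖w‖ ^ 2) : ℂ) *
        planeWave ξ w) + (4 * m ^ 2 : ℝ) * ((logBump (m + 1) ψ X κ (‖w‖ ^ 2) : ℂ) *
        planeWave ξ w) := by
    intro w
    rw [← mul_logBump_succ (m := m + 1) (ψ := ψ), ← mul_logBump_succ (m := m + 1) (ψ := deriv ψ),
      ← mul_logBump_succ (m := m + 1) (ψ := deriv (deriv ψ))]
    push_cast
    ring
  rw [integral_congr_ae (Filter.Eventually.of_forall e)] at key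
  have J := (I₂.const_mul ((4 * X⁻¹ ^ 2 : ℝ) : ℂ)).sub (I₁.const_mul ((8 * m * X⁻¹ : ℝ) : ℂ))
  simp only [Pi.sub_def] at J
  rw [integral_add J (I₀.const_mul _), integral_sub (I₂.const_mul _) (I₁.const_mul _),
    integral_const_mul, integral_const_mul, integral_const_mul] at key
  change _ = _ * radialFourier m ψ X κ ξ at key
  change _ * radialFourier _ _ _ _ _ - _ * radialFourier _ _ _ _ _ +
    _ * radialFourier _ _ _ _ _ = _ at key
  push_cast at key ⊢
  linear_combination (1 / 4 : ℂ) * key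

theorem exists_norm_radialFourier_le {α₁ α₂ : ℝ} (M N : ℕ) :
    ∀ (m : ℕ), 3 ≤ m + N → ∀ ψ : ℝ → ℝ, ContDiff ℝ (⊤ : ℕ∞) ψ →
      Function.support ψ ⊆ Set.Icc α₁ α₂ →
      ∃ C : ℝ, 0 ≤ C ∧ ∀ (X κ s : ℝ) (ξ : ℂ), 1 / 2 ≤ X → 0 < s → s ≤ Real.exp (X * α₁ - κ) →
        (‖ξ‖ ^ 2) ^ N * ‖radialFourier m ψ X κ ξ‖ ≤ C * (X ^ M)⁻¹ * (s * (s ^ (m + N))⁻¹) := by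
  induction N with
  | zero =>
    intro m hm ψ hs hψ
    obtain ⟨n, rfl⟩ : ∃ n, m = n + 1 := ⟨m - 1, by omega⟩
    obtain ⟨C, hC0, hC⟩ := exists_abs_logBump_le n M hs hψ
    refine ⟨C * ∫ w : ℂ, ((1 + ‖w‖ ^ 2) ^ n)⁻¹, by positivity, fun X κ s ξ hX hs0 hsX ↦ ?_⟩
    have hX0 : 0 < X := by linarith
    rw [pow_zero, one_mul]
    calc ‖radialFourier (n + 1) ψ X κ ξ‖
        ≤ ∫ w : ℂ, C * (X ^ M)⁻¹ * s⁻¹ * ((s + ‖w‖ ^ 2) ^ n)⁻¹ := by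
          refine norm_integral_le_of_norm_le
            ((integrable_inv_add_norm_sq_pow (by omega) hs0).const_mul _)
            (Filter.Eventually.of_forall fun w ↦ ?_)
          rw [norm_mul, norm_planeWave, mul_one, Complex.norm_real, Real.norm_eq_abs]
          exact hC X κ s _ hX0 hs0 hsX (by positivity)
      _ = _ := by
          rw [integral_const_mul, integral_inv_add_norm_sq_pow n hs0, add_zero]
          field_simp
          ring
  | succ N ih =>
    intro m hm ψ hs hψ
    have hs₁ := (contDiff_infty_iff_deriv.1 hs)
    have hs₂ := (contDiff_infty_iff_deriv.1 hs₁.2)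
    have hψ₁ := support_deriv_subset_Icc hψ
    have hψ₂ := support_deriv_subset_Icc hψ₁
    obtain ⟨C₀, hC₀, h₀⟩ := ih (m + 1) (by omega) ψ hs hψ
    obtain ⟨C₁, hC₁, h₁⟩ := ih (m + 1) (by omega) _ hs₁.2 hψ₁
    obtain ⟨C₂, hC₂, h₂⟩ := ih (m + 1) (by omega) _ hs₂.2 hψ₂
    refine ⟨4 * C₂ + 4 * m * C₁ + m ^ 2 * C₀, by positivity, fun X κ s ξ hX hs0 hsX ↦ ?_⟩
    have hX0 : 0 < X := by linarith
    specialize h₀ X κ s ξ hX hs0 hsX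
    specialize h₁ X κ s ξ hX hs0 hsX
    specialize h₂ X κ s ξ hX hs0 hsX
    have hXi : X⁻¹ ≤ 2 := by
      rw [inv_le_comm₀ hX0 two_pos]
      linarith
    have hXi0 : 0 ≤ X⁻¹ := (inv_pos.2 hX0).le
    have key := congrArg norm (norm_sq_mul_radialFourier hs hψ m κ hX0 ξ)
    rw [norm_mul, Complex.norm_real, Real.norm_of_nonneg (by positivity), norm_neg] at key
    have hle : ‖ξ‖ ^ 2 * ‖radialFourier m ψ X κ ξ‖ ≤
        4 * ‖radialFourier (m + 1) (deriv (deriv ψ)) X κ ξ‖ +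
        4 * m * ‖radialFourier (m + 1) (deriv ψ) X κ ξ‖ +
        m ^ 2 * ‖radialFourier (m + 1) ψ X κ ξ‖ := by
      calc ‖ξ‖ ^ 2 * ‖radialFourier m ψ X κ ξ‖
          ≤ Real.pi ^ 2 * (‖ξ‖ ^ 2 * ‖radialFourier m ψ X κ ξ‖) :=
            le_mul_of_one_le_left (by positivity) (one_le_pow₀ (by linarith [Real.pi_gt_three]))
        _ = _ := by rw [← mul_assoc]; exact key
        _ ≤ _ := (norm_add_le _ _).trans (add_le_add_left (norm_sub_le _ _) _)
        _ ≤ _ := by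
            have h4 : ‖((X⁻¹ ^ 2 : ℝ) : ℂ)‖ ≤ 4 := by
              rw [Complex.norm_real, Real.norm_of_nonneg (by positivity)]
              nlinarith
            have h2 : ‖((2 * m * X⁻¹ : ℝ) : ℂ)‖ ≤ 4 * m := by
              rw [Complex.norm_real, Real.norm_of_nonneg (by positivity)]
              nlinarith [(Nat.cast_nonneg m : (0 : ℝ) ≤ m)]
            have h0 : ‖((m ^ 2 : ℝ) : ℂ)‖ ≤ m ^ 2 := by
              rw [Complex.norm_real, Real.norm_of_nonneg (by positivity)]
            simp only [norm_mul ((_ : ℝ) : ℂ)]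
            gcongr
    calc (‖ξ‖ ^ 2) ^ (N + 1) * ‖radialFourier m ψ X κ ξ‖
        = (‖ξ‖ ^ 2) ^ N * (‖ξ‖ ^ 2 * ‖radialFourier m ψ X κ ξ‖) := by ring
      _ ≤ (‖ξ‖ ^ 2) ^ N * (4 * ‖radialFourier (m + 1) (deriv (deriv ψ)) X κ ξ‖ +
          4 * m * ‖radialFourier (m + 1) (deriv ψ) X κ ξ‖ +
          m ^ 2 * ‖radialFourier (m + 1) ψ X κ ξ‖) := by gcongr
      _ = 4 * ((‖ξ‖ ^ 2) ^ N * ‖radialFourier (m + 1) (deriv (deriv ψ)) X κ ξ‖) +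
          4 * m * ((‖ξ‖ ^ 2) ^ N * ‖radialFourier (m + 1) (deriv ψ) X κ ξ‖) +
          m ^ 2 * ((‖ξ‖ ^ 2) ^ N * ‖radialFourier (m + 1) ψ X κ ξ‖) := by ring
      _ ≤ 4 * (C₂ * (X ^ M)⁻¹ * (s * (s ^ (m + 1 + N))⁻¹)) +
          4 * m * (C₁ * (X ^ M)⁻¹ * (s * (s ^ (m + 1 + N))⁻¹)) +
          m ^ 2 * (C₀ * (X ^ M)⁻¹ * (s * (s ^ (m + 1 + N))⁻¹)) := by gcongr
      _ = _ := by rw [show m + (N + 1) = m + 1 + N by ring]; ring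

open scoped FourierTransform SchwartzMap in
theorem tsum_int_eq_tsum_fourier_of_hasCompactSupport {f : ℝ → ℂ} (hc : Continuous f)
    (hf : HasCompactSupport f) (hs : Summable fun n : ℤ ↦ 𝓕 f n) :
    ∑' n : ℤ, f n = ∑' n : ℤ, 𝓕 f n := by
  have h : f =O[Filter.cocompact ℝ] fun x : ℝ ↦ |x| ^ (-2 : ℝ) := by
    have := hasCompactSupport_iff_eventuallyEq.1 hf
    rw [Filter.coclosedCompact_eq_cocompact] at this
    exact this.trans_isBigO (Asymptotics.isBigO_zero _ _)
  simpa using Real.tsum_eq_tsum_fourier_of_rpow_decay_of_summable hc one_lt_two h hs 0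

open scoped FourierTransform SchwartzMap in
theorem summable_fourier_of_contDiff_of_hasCompactSupport {f : ℝ → ℂ}
    (hc : ContDiff ℝ (⊤ : ℕ∞) f) (hf : HasCompactSupport f) :
    Summable fun n : ℤ ↦ 𝓕 f n := by
  have h := (𝓕 (hf.toSchwartzMap hc)).isBigO_cocompact_rpow (-2)
  exact summable_of_isBigO (Real.summable_abs_int_rpow one_lt_two)
    (h.comp_tendsto Int.tendsto_coe_cofinite)

/-- The character `(x, y) ↦ exp(-2πi(ax + by))` of `ℝ²`. -/
noncomputable def planeChar (a b x y : ℝ) : ℂ :=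
  Complex.exp (((-2 * Real.pi * (x * a) : ℝ) : ℂ) * Complex.I) *
    Complex.exp (((-2 * Real.pi * (y * b) : ℝ) : ℂ) * Complex.I)

open scoped FourierTransform in
/-- **Poisson summation** in the plane for smooth compactly supported functions. -/
theorem tsum_int_prod_eq_tsum_integral_planeChar {G : ℝ × ℝ → ℂ} (hG : ContDiff ℝ (⊤ : ℕ∞) G)
    (hGc : HasCompactSupport G)
    (hs : Summable fun v : ℤ × ℤ ↦ ∫ p : ℝ × ℝ, G p * planeChar v.1 v.2 p.1 p.2) :
    ∑' v : ℤ × ℤ, G (v.1, v.2) =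
      ∑' v : ℤ × ℤ, ∫ p : ℝ × ℝ, G p * planeChar v.1 v.2 p.1 p.2 := by
  obtain ⟨R, hR⟩ : ∃ R : ℝ, ∀ p : ℝ × ℝ, G p ≠ 0 → |p.1| ≤ R ∧ |p.2| ≤ R := by
    obtain ⟨R, hR⟩ := hGc.isBounded.exists_norm_le
    refine ⟨R, fun p hp ↦ ?_⟩
    have := hR p (subset_tsupport _ hp)
    rw [Prod.norm_def, max_le_iff] at this
    exact this
  have slice_supp (x : ℝ) : HasCompactSupport fun y ↦ G (x, y) :=
    HasCompactSupport.of_support_subset_isCompact (isCompact_Icc (a := -R) (b := R))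
      fun y hy ↦ abs_le.1 (hR _ hy).2
  have slice_diff (x : ℝ) : ContDiff ℝ (⊤ : ℕ∞) fun y ↦ G (x, y) := by fun_prop
  have hGcont := hG.continuous
  set H : ℝ → ℝ → ℂ := fun x b ↦ 𝓕 (fun y ↦ G (x, y)) b with hH
  have H_eq (x b : ℝ) : H x b =
      ∫ y, Complex.exp (((-2 * Real.pi * y * b : ℝ) : ℂ) * Complex.I) • G (x, y) :=
    Real.fourier_real_eq_integral_exp_smul _ _
  have H_zero (x b : ℝ) (hx : R < |x|) : H x b = 0 := by
    rw [H_eq]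
    have : ∀ y, G (x, y) = 0 := fun y ↦ by
      by_contra hne
      exact ((hR _ hne).1).not_gt hx
    simp [this]
  have H_cont (b : ℝ) : Continuous fun x ↦ H x b := by
    have h1 : ∀ x, H x b = ∫ y in Set.Icc (-R) R,
        Complex.exp (((-2 * Real.pi * y * b : ℝ) : ℂ) * Complex.I) • G (x, y) := by
      intro x
      rw [H_eq, setIntegral_eq_integral_of_forall_compl_eq_zero]
      intro y hy
      have : G (x, y) = 0 := by
        by_contra hne
        exact hy (abs_le.1 (hR _ hne).2)
      rw [this, smul_zero]
    simp only [h1]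
    refine continuous_parametric_integral_of_continuous ?_ isCompact_Icc
    unfold Function.uncurry
    fun_prop
  have H_supp (b : ℝ) : HasCompactSupport fun x ↦ H x b :=
    HasCompactSupport.of_support_subset_isCompact (isCompact_Icc (a := -R) (b := R))
      fun x hx ↦ abs_le.1 (not_lt.1 fun h ↦ hx (H_zero x b h))
  have hchar (a b : ℝ) : Continuous fun p : ℝ × ℝ ↦ planeChar a b p.1 p.2 := by
    unfold planeChar
    fun_prop
  have H_fourier (a b : ℝ) : 𝓕 (fun x ↦ H x b) a =
      ∫ p : ℝ × ℝ, G p * planeChar a b p.1 p.2 := by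
    rw [Real.fourier_real_eq_integral_exp_smul]
    rw [Measure.volume_eq_prod, integral_prod]
    · refine integral_congr_ae (Filter.Eventually.of_forall fun x ↦ ?_)
      simp only
      rw [H_eq, smul_eq_mul, ← integral_const_mul]
      refine integral_congr_ae (Filter.Eventually.of_forall fun y ↦ ?_)
      simp only [planeChar, smul_eq_mul, ← mul_assoc]
      ring
    · exact Continuous.integrable_of_hasCompactSupport (hGcont.mul (hchar a b)) hGc.mul_right
  have slice_zero (m : ℤ) (hm : m ∉ Finset.Icc (-⌈R⌉) ⌈R⌉) : R < |(m : ℝ)| := by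
    by_contra hle
    rw [not_lt, abs_le] at hle
    refine hm (Finset.mem_Icc.2 ⟨?_, ?_⟩)
    · have : (-(m : ℝ)) ≤ ⌈R⌉ := by linarith [Int.le_ceil R]
      have : -m ≤ ⌈R⌉ := by exact_mod_cast this
      linarith
    · exact_mod_cast hle.2.trans (Int.le_ceil R)
  have hsumG : Summable fun v : ℤ × ℤ ↦ G (v.1, v.2) := by
    refine summable_of_ne_finset_zero (s := Finset.Icc (-⌈R⌉) ⌈R⌉ ×ˢ Finset.Icc (-⌈R⌉) ⌈R⌉)
      fun v hv ↦ ?_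
    by_contra hne
    refine hv (Finset.mem_product.2 ⟨?_, ?_⟩)
    · by_contra h
      exact (hR _ hne).1.not_gt (slice_zero _ h)
    · by_contra h
      exact (hR _ hne).2.not_gt (slice_zero _ h)
  calc ∑' v : ℤ × ℤ, G (v.1, v.2)
      = ∑' m : ℤ, ∑' n : ℤ, G (m, n) := hsumG.tsum_prod
    _ = ∑' m : ℤ, ∑' n : ℤ, H m n := tsum_congr fun m ↦
        tsum_int_eq_tsum_fourier_of_hasCompactSupport (slice_diff m).continuous (slice_supp m)
          (summable_fourier_of_contDiff_of_hasCompactSupport (slice_diff m) (slice_supp m))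
    _ = ∑ m ∈ Finset.Icc (-⌈R⌉) ⌈R⌉, ∑' n : ℤ, H m n := tsum_eq_sum fun m hm ↦ by
        simp [H_zero _ _ (slice_zero m hm)]
    _ = ∑' n : ℤ, ∑ m ∈ Finset.Icc (-⌈R⌉) ⌈R⌉, H m n :=
        (Summable.tsum_finsetSum (f := fun m n : ℤ ↦ H m n) fun m _ ↦
          summable_fourier_of_contDiff_of_hasCompactSupport (slice_diff m) (slice_supp m)).symm
    _ = ∑' n : ℤ, ∑' m : ℤ, H m n := tsum_congr fun n ↦ (tsum_eq_sum fun m hm ↦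
        H_zero _ _ (slice_zero m hm)).symm
    _ = ∑' n : ℤ, ∑' m : ℤ, ∫ p : ℝ × ℝ, G p * planeChar m n p.1 p.2 := tsum_congr fun n ↦ by
        rw [tsum_int_eq_tsum_fourier_of_hasCompactSupport (H_cont n) (H_supp n)]
        · exact tsum_congr fun m ↦ H_fourier m n
        · simp only [H_fourier]
          exact hs.comp_injective (i := fun m : ℤ ↦ (m, n)) fun _ _ h ↦ (Prod.mk.inj h).1
    _ = _ := by
        rw [hs.tsum_prod]
        exact (Summable.tsum_comm
          (f := fun m n : ℤ ↦ ∫ p : ℝ × ℝ, G p * planeChar m n p.1 p.2) hs)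

/-- The real-linear map `(x, y) ↦ x z₁ + y z₂`. -/
noncomputable def planeMap (z₁ z₂ : ℂ) : ℂ →ₗ[ℝ] ℂ :=
  Complex.reLm.smulRight z₁ + Complex.imLm.smulRight z₂

theorem planeMap_apply (z₁ z₂ w : ℂ) : planeMap z₁ z₂ w = w.re * z₁ + w.im * z₂ := by
  simp [planeMap]

theorem det_planeMap (z₁ z₂ : ℂ) :
    LinearMap.det (planeMap z₁ z₂) = (starRingEnd ℂ z₁ * z₂).im := by
  rw [← LinearMap.det_toMatrix Complex.basisOneI, Matrix.det_fin_two]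
  simp [LinearMap.toMatrix_apply, planeMap_apply]
  ring

theorem integral_comp_planeMap {z₁ z₂ : ℂ} (hd : (starRingEnd ℂ z₁ * z₂).im ≠ 0) (g : ℂ → ℂ) :
    ∫ p : ℝ × ℝ, g (p.1 * z₁ + p.2 * z₂) =
      (|(starRingEnd ℂ z₁ * z₂).im|⁻¹ : ℝ) * ∫ w, g w := by
  have h1 := Complex.volume_preserving_equiv_real_prod.integral_comp
    Complex.measurableEquivRealProd.measurableEmbedding
    (fun p : ℝ × ℝ ↦ g (p.1 * z₁ + p.2 * z₂))
  rw [← h1]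
  have hdet : LinearMap.det (planeMap z₁ z₂) ≠ 0 := by rwa [det_planeMap]
  have hme : MeasurableEmbedding (planeMap z₁ z₂) :=
    ((planeMap z₁ z₂).equivOfDetNeZero
      hdet).toContinuousLinearEquiv.toHomeomorph.measurableEmbedding
  have h2 := hme.integral_map (μ := volume) g
  rw [Measure.map_linearMap_addHaar_eq_smul_addHaar _ hdet, integral_smul_measure, det_planeMap,
    ENNReal.toReal_ofReal (abs_nonneg _), abs_inv] at h2
  simp only [planeMap_apply] at h2
  rw [Complex.real_smul] at h2
  rw [h2]
  rfl

/-- The dual lattice vector pairing to `a` with `z₁` and to `b` with `z₂`. -/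
noncomputable def dualVector (z₁ z₂ : ℂ) (a b : ℝ) : ℂ :=
  (b * z₁ - a * z₂) * Complex.I / ((starRingEnd ℂ z₁ * z₂).im : ℂ)

theorem norm_dualVector (z₁ z₂ : ℂ) (a b : ℝ) :
    ‖dualVector z₁ z₂ a b‖ = ‖b * z₁ - a * z₂‖ / |(starRingEnd ℂ z₁ * z₂).im| := by
  rw [dualVector, norm_div, norm_mul, Complex.norm_I, mul_one, Complex.norm_real,
    Real.norm_eq_abs]

theorem planeWave_dualVector {z₁ z₂ : ℂ} (hd : (starRingEnd ℂ z₁ * z₂).im ≠ 0) (a b x y : ℝ) :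
    planeWave (dualVector z₁ z₂ a b) (x * z₁ + y * z₂) = planeChar a b x y := by
  rw [planeWave, planeChar, ← Complex.exp_add, ← add_mul, ← Complex.ofReal_add]
  have : inner ℝ ((x : ℂ) * z₁ + y * z₂) (dualVector z₁ z₂ a b) = x * a + y * b := by
    rw [Complex.inner, dualVector, div_mul_eq_mul_div, Complex.div_ofReal_re, div_eq_iff hd]
    simp
    ring
  rw [this]
  congr 3
  ring

/-- **Poisson summation** over a planar lattice. -/
theorem tsum_lattice_eq_tsum_planeWave {g : ℂ → ℂ} (hg : ContDiff ℝ (⊤ : ℕ∞) g)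
    (hgc : HasCompactSupport g) {z₁ z₂ : ℂ} (hd : (starRingEnd ℂ z₁ * z₂).im ≠ 0)
    (hs : Summable fun v : ℤ × ℤ ↦ ∫ w, g w * planeWave (dualVector z₁ z₂ v.1 v.2) w) :
    ∑' v : ℤ × ℤ, g (v.1 * z₁ + v.2 * z₂) = (|(starRingEnd ℂ z₁ * z₂).im|⁻¹ : ℝ) *
      ∑' v : ℤ × ℤ, ∫ w, g w * planeWave (dualVector z₁ z₂ v.1 v.2) w := by
  have hdet : LinearMap.det (planeMap z₁ z₂) ≠ 0 := by rwa [det_planeMap]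
  let e := Complex.equivRealProdCLM.symm.trans
    ((planeMap z₁ z₂).equivOfDetNeZero hdet).toContinuousLinearEquiv
  have he : (fun p : ℝ × ℝ ↦ g (p.1 * z₁ + p.2 * z₂)) = g ∘ e :=
    funext fun p ↦ congrArg g (planeMap_apply z₁ z₂ (Complex.equivRealProdCLM.symm p)).symm
  have hc : HasCompactSupport fun p : ℝ × ℝ ↦ g (p.1 * z₁ + p.2 * z₂) :=
    he ▸ hgc.comp_homeomorph e.toHomeomorph
  have hcd : ContDiff ℝ (⊤ : ℕ∞) fun p : ℝ × ℝ ↦ g (p.1 * z₁ + p.2 * z₂) :=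
    he ▸ hg.comp e.contDiff
  have key (v : ℤ × ℤ) : ∫ p : ℝ × ℝ, g (p.1 * z₁ + p.2 * z₂) * planeChar v.1 v.2 p.1 p.2 =
      (|(starRingEnd ℂ z₁ * z₂).im|⁻¹ : ℝ) *
        ∫ w, g w * planeWave (dualVector z₁ z₂ v.1 v.2) w := by
    rw [← integral_comp_planeMap hd]
    simp only [planeWave_dualVector hd]
  rw [← tsum_mul_left]
  simp only [← key]
  have := tsum_int_prod_eq_tsum_integral_planeChar
    (G := fun p : ℝ × ℝ ↦ g (p.1 * z₁ + p.2 * z₂)) hcd hc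
    (by simpa only [key] using hs.mul_left _)
  simpa using this

theorem integral_logBump_norm_sq (ψ : ℝ → ℝ) {X : ℝ} (κ : ℝ) (hX : 0 < X) :
    ∫ w : ℂ, logBump 1 ψ X κ (‖w‖ ^ 2) = Real.pi * X * ∫ u, ψ u := by
  have h1 := integral_fun_norm_addHaar (volume : Measure ℂ) fun r ↦ logBump 1 ψ X κ (r ^ 2)
  rw [h1, Complex.finrank_real_complex, Measure.real, Complex.volume_ball]
  have h2 := integral_image_eq_integral_abs_deriv_smul (s := Set.univ) (f := Real.exp)
    (f' := Real.exp) MeasurableSet.univ (fun x _ ↦ (Real.hasDerivAt_exp x).hasDerivWithinAt)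
    Real.exp_injective.injOn (fun y ↦ y ^ (2 - 1) • logBump 1 ψ X κ (y ^ 2))
  rw [Set.image_univ, Real.range_exp, setIntegral_univ] at h2
  have h3 (x : ℝ) : |Real.exp x| • (Real.exp x ^ (2 - 1) • logBump 1 ψ X κ (Real.exp x ^ 2)) =
      ψ ((2 / X) * x + κ / X) := by
    rw [logBump_of_pos (by positivity), Real.log_pow, Real.log_exp, abs_of_pos (Real.exp_pos x),
      smul_eq_mul, smul_eq_mul]
    have : (((2 : ℕ) : ℝ) * x + κ) / X = (2 / X) * x + κ / X := by
      push_cast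
      ring
    rw [this]
    field_simp
    norm_num
  have h4 := Measure.integral_comp_mul_left (fun y ↦ ψ (y + κ / X)) (2 / X)
  rw [integral_add_right_eq_self ψ] at h4
  rw [h2]
  simp only [h3, h4]
  rw [abs_of_pos (by positivity)]
  simp
  ring

theorem lattice_vector_ne_zero {z₁ z₂ : ℂ} (hd : (starRingEnd ℂ z₁ * z₂).im ≠ 0) {a b : ℝ}
    (h : (a, b) ≠ 0) : a * z₁ + b * z₂ ≠ 0 := by
  intro h0
  have h1 : (starRingEnd ℂ z₁ * (a * z₁ + b * z₂)).im = b * (starRingEnd ℂ z₁ * z₂).im := by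
    simp
    ring
  have h2 : (starRingEnd ℂ z₂ * (a * z₁ + b * z₂)).im = -a * (starRingEnd ℂ z₁ * z₂).im := by
    simp
    ring
  rw [h0, mul_zero, Complex.zero_im, eq_comm, mul_eq_zero] at h1 h2
  refine h (Prod.ext ?_ ?_)
  · simpa using h2.resolve_right hd
  · simpa using h1.resolve_right hd

/-- Poisson summation bounds the deviation of a lattice sum of `logBump` from its main term by
a sum over the lattice itself. -/
theorem exists_norm_tsum_logBump_sub_le {α₁ α₂ : ℝ} (M : ℕ) {φ : ℝ → ℝ}
    (hφ : ContDiff ℝ (⊤ : ℕ∞) φ) (hφs : Function.support φ ⊆ Set.Icc α₁ α₂) :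
    ∃ C : ℝ, 0 ≤ C ∧ ∀ (X κ D : ℝ) (z₁ z₂ : ℂ), 1 / 2 ≤ X → 0 < D → D ≤ Real.exp (X * α₁ - κ) →
      |(starRingEnd ℂ z₁ * z₂).im| = Real.sqrt D / 2 →
      (Summable fun v : ℤ × ℤ ↦ ((‖v.1 * z₁ + v.2 * z₂‖ ^ 2) ^ 4)⁻¹) →
      |∑' v : ℤ × ℤ, logBump 1 φ X κ (‖v.1 * z₁ + v.2 * z₂‖ ^ 2) -
        2 / Real.sqrt D * (Real.pi * X * ∫ u, φ u)| ≤
      C * (X ^ M)⁻¹ * (Real.sqrt D)⁻¹ *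
        ∑' v : ℤ × ℤ, ((‖v.1 * z₁ + v.2 * z₂‖ ^ 2) ^ 4)⁻¹ := by
  obtain ⟨C, hC0, hC⟩ := exists_norm_radialFourier_le (α₁ := α₁) (α₂ := α₂) M 4 1 (by norm_num)
    φ hφ hφs
  refine ⟨2 * C, by positivity, fun X κ D z₁ z₂ hX hD hDX hd hsum ↦ ?_⟩
  have hX0 : 0 < X := by linarith
  have hsD : 0 < Real.sqrt D := Real.sqrt_pos.2 hD
  have hd0 : (starRingEnd ℂ z₁ * z₂).im ≠ 0 := by
    rw [← abs_pos, hd]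
    positivity
  set B : ℤ × ℤ → ℝ := fun v ↦ ((‖v.1 * z₁ + v.2 * z₂‖ ^ 2) ^ 4)⁻¹ with hB
  have hB0 (v) : 0 ≤ B v := by positivity
  let σ : ℤ × ℤ ≃ ℤ × ℤ := (Equiv.prodComm ℤ ℤ).trans ((Equiv.refl ℤ).prodCongr (Equiv.neg ℤ))
  have hbound (v : ℤ × ℤ) (hv : v ≠ 0) :
      ‖radialFourier 1 φ X κ (dualVector z₁ z₂ v.1 v.2)‖ ≤ C * (X ^ M)⁻¹ * B (σ v) := by
    have hz : 0 < ‖(v.2 : ℂ) * z₁ - v.1 * z₂‖ := by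
      have := lattice_vector_ne_zero hd0 (a := v.2) (b := -v.1) (fun h ↦ hv (by
        simp only [Prod.mk_eq_zero, neg_eq_zero, Int.cast_eq_zero] at h
        exact Prod.ext h.2 h.1))
      rw [norm_pos_iff]
      simpa [sub_eq_add_neg] using this
    have hBσ : B (σ v) = ((‖(v.2 : ℂ) * z₁ - v.1 * z₂‖ ^ 2) ^ 4)⁻¹ := by
      simp [hB, σ, sub_eq_add_neg]
    have h := hC X κ D (dualVector z₁ z₂ v.1 v.2) hX hD hDX
    rw [norm_dualVector, hd, div_pow, div_pow (√D), Real.sq_sqrt hD.le] at h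
    rw [hBσ, ← div_eq_mul_inv, le_div_iff₀ (by positivity)]
    push_cast at h
    set r := ‖(v.2 : ℂ) * z₁ - v.1 * z₂‖ ^ 2
    set F := ‖radialFourier 1 φ X κ (dualVector z₁ z₂ v.1 v.2)‖
    have e : (r / (D / 2 ^ 2)) ^ 4 * F = 256 * (F * r ^ 4) * (D ^ 4)⁻¹ := by
      field_simp
      ring
    have e' : C * (X ^ M)⁻¹ * (D * (D ^ 5)⁻¹) = C * (X ^ M)⁻¹ * (D ^ 4)⁻¹ := by
      field_simp
    rw [e, e'] at h
    have := le_of_mul_le_mul_right h (by positivity)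
    have : 0 ≤ F * r ^ 4 := by positivity
    linarith
  have hBs : Summable fun v ↦ C * (X ^ M)⁻¹ * B (σ v) :=
    (σ.summable_iff.2 hsum).mul_left _
  have hs : Summable fun v : ℤ × ℤ ↦ radialFourier 1 φ X κ (dualVector z₁ z₂ v.1 v.2) := by
    refine hBs.of_norm_bounded_eventually ?_
    filter_upwards [(Set.finite_singleton (0 : ℤ × ℤ)).compl_mem_cofinite] with v hv
    exact hbound v hv
  have hcd : ContDiff ℝ (⊤ : ℕ∞) fun w : ℂ ↦ (logBump 1 φ X κ (‖w‖ ^ 2) : ℂ) :=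
    Complex.ofRealCLM.contDiff.comp ((contDiff_logBump hφs hX0 hφ).comp (contDiff_norm_sq ℝ))
  have hcs : HasCompactSupport fun w : ℂ ↦ (logBump 1 φ X κ (‖w‖ ^ 2) : ℂ) :=
    (hasCompactSupport_comp_norm_sq (hasCompactSupport_logBump hφs hX0)).comp_left
      (g := fun r : ℝ ↦ (r : ℂ)) Complex.ofReal_zero
  have key := tsum_lattice_eq_tsum_planeWave hcd hcs hd0 hs
  change _ = _ * ∑' v : ℤ × ℤ, radialFourier 1 φ X κ (dualVector z₁ z₂ v.1 v.2) at key
  have hzero : radialFourier 1 φ X κ (dualVector z₁ z₂ (0 : ℤ × ℤ).1 (0 : ℤ × ℤ).2) =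
      ((Real.pi * X * ∫ u, φ u : ℝ) : ℂ) := by
    rw [← integral_logBump_norm_sq φ κ hX0, ← integral_complex_ofReal]
    simp [radialFourier, planeWave, dualVector]
  rw [hs.tsum_eq_add_tsum_ite 0, hzero, hd, mul_add, ← Complex.ofReal_mul, inv_div] at key
  rw [← Real.norm_eq_abs, ← Complex.norm_real, Complex.ofReal_sub, Complex.ofReal_tsum, key,
    add_sub_cancel_left, norm_mul, Complex.norm_real, Real.norm_of_nonneg (by positivity)]
  have hle : ‖∑' v : ℤ × ℤ, if v = 0 then 0 else
      radialFourier 1 φ X κ (dualVector z₁ z₂ v.1 v.2)‖ ≤ ∑' v, C * (X ^ M)⁻¹ * B (σ v) := by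
    refine tsum_of_norm_bounded hBs.hasSum fun v ↦ ?_
    split_ifs with hv
    · rw [norm_zero]
      exact mul_nonneg (by positivity) (hB0 _)
    · exact hbound v hv
  rw [tsum_mul_left, σ.tsum_eq B] at hle
  calc _ ≤ 2 / Real.sqrt D * (C * (X ^ M)⁻¹ * ∑' v, B v) := by gcongr
    _ = _ := by ring

end Analysis

section RingOfIntegers

variable {K : Type} [Field K] [NumberField K] {D : ℕ} {α : K}

lemma ratCast_add_mul_eq_zero (hD : 0 < D) (hα : α ^ 2 = -(D : K)) {p q : ℚ}
    (h : (p : K) + q * α = 0) : p = 0 ∧ q = 0 := by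
  have hq : q = 0 := by
    by_contra hq
    have hqK : (q : K) ≠ 0 := by exact_mod_cast hq
    have h2 : (p : K) ^ 2 = q ^ 2 * (-(D : K)) := by
      rw [← hα, eq_neg_of_add_eq_zero_left h]; ring
    have h3 : p ^ 2 = q ^ 2 * (-(D : ℚ)) := by exact_mod_cast h2
    have hD' : (0 : ℚ) < D := by exact_mod_cast hD
    have : 0 < q ^ 2 := by positivity
    nlinarith [sq_nonneg p]
  subst hq
  simpa using h

lemma exists_eq_ratCast_add_mul (hD : 0 < D) (hfin : Module.finrank ℚ K = 2)
    (hα : α ^ 2 = -(D : K)) :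
    ∃ b : Module.Basis (Fin 2) ℚ K, b 0 = 1 ∧ b 1 = α := by
  have hli : LinearIndependent ℚ ![(1 : K), α] := by
    rw [LinearIndependent.pair_iff]
    intro s t hst
    refine ratCast_add_mul_eq_zero hD hα (p := s) (q := t) ?_
    simpa [Algebra.smul_def] using hst
  refine ⟨basisOfLinearIndependentOfCardEqFinrank hli (by simp [hfin]), ?_, ?_⟩ <;> simp

lemma exists_int_of_isIntegral_add_mul (hD : 0 < D) (hfin : Module.finrank ℚ K = 2)
    (hα : α ^ 2 = -(D : K)) {p q : ℚ} (h : IsIntegral ℤ ((p : K) + q * α)) :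
    (∃ s : ℤ, 2 * p = s) ∧ ∃ n : ℤ, p ^ 2 + D * q ^ 2 = n := by
  obtain ⟨b, hb0, hb1⟩ := exists_eq_ratCast_add_mul hD hfin hα
  have hM : Algebra.leftMulMatrix b ((p : K) + q * α) = !![p, -(D * q); q, p] := by
    have h0 : ((p : K) + q * α) * b 0 = p • b 0 + q • b 1 := by
      simp [hb0, hb1, Algebra.smul_def]
    have h1 : ((p : K) + q * α) * b 1 = (-(D * q)) • b 0 + p • b 1 := by
      rw [hb0, hb1]
      simp only [Algebra.smul_def, eq_ratCast]
      push_cast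
      linear_combination (q : K) * hα
    ext i j
    rw [Algebra.leftMulMatrix_eq_repr_mul]
    fin_cases j <;> fin_cases i <;> simp [h0, h1]
  have ht := Algebra.isIntegral_trace (L := ℚ) h
  have hn := Algebra.isIntegral_norm ℚ h
  rw [Algebra.trace_eq_matrix_trace b, hM, Matrix.trace_fin_two] at ht
  rw [Algebra.norm_eq_matrix_det b, hM, Matrix.det_fin_two] at hn
  obtain ⟨s, hs⟩ := IsIntegrallyClosed.isIntegral_iff.1 ht
  obtain ⟨n, hn⟩ := IsIntegrallyClosed.isIntegral_iff.1 hn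
  refine ⟨⟨s, ?_⟩, n, ?_⟩
  · simp at hs; linarith
  · simp at hn; linarith

lemma exists_int_eq_of_prime_mul_sq [hp : Fact D.Prime] {t : ℚ} {n : ℤ} (h : D * t ^ 2 = n) :
    ∃ m : ℤ, t = m := by
  have hintegral : IsIntegral ℤ ((D : ℚ) * t) := by
    refine IsIntegral.of_pow (n := 2) (by norm_num) ?_
    have : ((D : ℚ) * t) ^ 2 = algebraMap ℤ ℚ (D * n) := by
      simp [← h]; ring
    rw [this]; exact isIntegral_algebraMap
  obtain ⟨u, hu⟩ := IsIntegrallyClosed.isIntegral_iff.1 hintegral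
  have hu' : (u : ℚ) = D * t := by simpa using hu
  have hsq : u ^ 2 = D * n := by
    have : (u : ℚ) ^ 2 = D * n := by rw [hu', ← h]; ring
    exact_mod_cast this
  have hdvd : (D : ℤ) ∣ u := (Nat.prime_iff_prime_int.1 hp.out).dvd_of_dvd_pow ⟨n, hsq⟩
  obtain ⟨m, rfl⟩ := hdvd
  refine ⟨m, ?_⟩
  have hD : (D : ℚ) ≠ 0 := by exact_mod_cast hp.out.ne_zero
  push_cast at hu'
  exact (mul_left_cancel₀ hD hu').symm

lemma exists_integral_basis [hp : Fact D.Prime] (hD4 : D % 4 = 3)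
    (hfin : Module.finrank ℚ K = 2) (hα : α ^ 2 = -(D : K)) :
    ∃ b : Module.Basis (Fin 2) ℤ (𝓞 K), b 0 = 1 ∧
      b 1 * b 1 = b 1 - (((D + 1) / 4 : ℕ) : 𝓞 K) := by
  have hD := hp.out.pos
  obtain ⟨m, hm⟩ : ∃ m, D + 1 = 4 * m := ⟨(D + 1) / 4, by omega⟩
  have hm' : (D + 1) / 4 = m := by omega
  rw [hm']
  have hmK : (D : K) + 1 = 4 * m := by exact_mod_cast hm
  have hω2 : ((1 + α) / 2) * ((1 + α) / 2) = (1 + α) / 2 - (m : K) := by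
    linear_combination hα / 4 - hmK / 4
  have hintegral : IsIntegral ℤ ((1 + α) / 2) := by
    refine ⟨Polynomial.X ^ 2 - Polynomial.X + Polynomial.C (m : ℤ), ?_, ?_⟩
    · rw [Polynomial.Monic, show (Polynomial.X ^ 2 - Polynomial.X + Polynomial.C (m : ℤ)) =
        Polynomial.X ^ 2 + (-Polynomial.X + Polynomial.C (m : ℤ)) by ring]
      refine Polynomial.monic_X_pow_add ?_
      compute_degree!
    · simp only [Polynomial.eval₂_add, Polynomial.eval₂_sub, Polynomial.eval₂_pow,
        Polynomial.eval₂_X, Polynomial.eval₂_C]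
      simp only [eq_intCast, Int.cast_natCast]
      linear_combination hω2
  obtain ⟨ω, hω⟩ : ∃ ω : 𝓞 K, (ω : K) = (1 + α) / 2 := ⟨⟨_, hintegral⟩, rfl⟩
  have hli : LinearIndependent ℤ ![(1 : 𝓞 K), ω] := by
    rw [LinearIndependent.pair_iff]
    intro s t hst
    have h1 : (s : K) + t * ((1 + α) / 2) = 0 := by
      rw [← hω]
      have := congrArg (algebraMap (𝓞 K) K) hst
      simpa [zsmul_eq_mul] using this
    have h2 := ratCast_add_mul_eq_zero hD hα (p := s + t / 2) (q := t / 2) (by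
      push_cast; linear_combination h1)
    have ht : (t : ℚ) = 0 := by linarith [h2.2]
    have hs : (s : ℚ) = 0 := by linarith [h2.1]
    exact ⟨by exact_mod_cast hs, by exact_mod_cast ht⟩
  have hspan : ⊤ ≤ Submodule.span ℤ (Set.range ![(1 : 𝓞 K), ω]) := by
    intro x _
    obtain ⟨b, hb0, hb1⟩ := exists_eq_ratCast_add_mul hD hfin hα
    obtain ⟨p, q, hx⟩ : ∃ p q : ℚ, (x : K) = p + q * α := by
      refine ⟨b.repr x 0, b.repr x 1, ?_⟩
      conv_lhs => rw [← b.sum_repr (x : K)]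
      simp [hb0, hb1, Algebra.smul_def]
    have hxi : IsIntegral ℤ ((p : K) + q * α) := hx ▸ x.isIntegral_coe
    obtain ⟨⟨s, hs⟩, n, hn⟩ := exists_int_of_isIntegral_add_mul hD hfin hα hxi
    obtain ⟨t, ht⟩ := exists_int_eq_of_prime_mul_sq (D := D) (t := 2 * q) (n := 4 * n - s ^ 2) (by
      push_cast; rw [← hs, ← hn]; ring)
    have h4 : s ^ 2 + D * t ^ 2 = 4 * n := by
      have : (s : ℚ) ^ 2 + D * t ^ 2 = 4 * n := by rw [← hs, ← hn, ← ht]; ring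
      exact_mod_cast this
    obtain ⟨r, hr⟩ : ∃ r, s - t = 2 * r := by
      have h5 : 4 ∣ (s - t) * (s + t) := ⟨n - m * t ^ 2, by
        have : (D : ℤ) = 4 * m - 1 := by omega
        rw [this] at h4; linear_combination h4⟩
      have : Even ((s - t) * (s + t)) := (even_iff_two_dvd.2 (dvd_trans (by norm_num) h5))
      rcases Int.even_mul.1 this with h | h
      · exact h.two_dvd
      · have : Even (s - t) := by
          have := h.sub (even_two_mul t)
          rwa [show s + t - 2 * t = s - t by ring] at this
        exact this.two_dvd
    have hxe : x = r • (1 : 𝓞 K) + t • ω := by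
      apply RingOfIntegers.ext
      simp only [zsmul_eq_mul, map_add, map_mul, map_intCast, mul_one, hω, hx]
      have hpK : (2 : K) * p = s := by exact_mod_cast congrArg (Rat.cast : ℚ → K) hs
      have hqK : (2 : K) * q = t := by exact_mod_cast congrArg (Rat.cast : ℚ → K) ht
      have hrK : (s : K) - t = 2 * r := by exact_mod_cast congrArg (Int.cast : ℤ → K) hr
      linear_combination hpK / 2 + α * hqK / 2 + hrK / 2
    rw [hxe]
    refine Submodule.add_mem _ (Submodule.smul_mem _ _ (Submodule.subset_span ⟨0, rfl⟩))
      (Submodule.smul_mem _ _ (Submodule.subset_span ⟨1, rfl⟩))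
  refine ⟨Module.Basis.mk hli hspan, by simp, ?_⟩
  simp only [Module.Basis.mk_apply, Matrix.cons_val_one, Matrix.cons_val_fin_one]
  apply RingOfIntegers.ext
  simp [hω, hω2]

end RingOfIntegers

section QuadraticInvariants

variable {K : Type} [Field K] [NumberField K] {D m : ℕ}

/-- A `ℤ`-basis `1, ω` of the ring of integers with `ω² = ω - m`, where `D + 1 = 4 m`. -/
structure IsHalfIntegralBasis (D m : ℕ) (b : Module.Basis (Fin 2) ℤ (𝓞 K)) : Prop where
  zero_eq_one : b 0 = 1
  one_mul_one : b 1 * b 1 = b 1 - (m : 𝓞 K)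
  add_one_eq : D + 1 = 4 * m

namespace IsHalfIntegralBasis

variable {b : Module.Basis (Fin 2) ℤ (𝓞 K)}

omit [NumberField K] in
lemma eq_add_mul (h : IsHalfIntegralBasis D m b) (x : 𝓞 K) :
    x = (b.repr x 0 : 𝓞 K) + (b.repr x 1 : 𝓞 K) * b 1 := by
  conv_lhs => rw [← b.sum_repr x]
  simp [h.zero_eq_one]

omit [NumberField K] in
lemma leftMulMatrix_eq (h : IsHalfIntegralBasis D m b) (r s : ℤ) :
    Algebra.leftMulMatrix b ((r : 𝓞 K) + s * b 1) = !![r, -(m * s); s, r + s] := by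
  have h0 : ((r : 𝓞 K) + s * b 1) * b 0 = r • b 0 + s • b 1 := by
    simp [h.zero_eq_one]
  have h1 : ((r : 𝓞 K) + s * b 1) * b 1 = (-(m * s)) • b 0 + (r + s) • b 1 := by
    simp only [h.zero_eq_one, zsmul_eq_mul]
    push_cast
    linear_combination (s : 𝓞 K) * h.one_mul_one
  ext i j
  rw [Algebra.leftMulMatrix_eq_repr_mul]
  fin_cases j <;> fin_cases i <;> simp [h0, h1, -zsmul_eq_mul]

omit [NumberField K] in
lemma norm_add_mul (h : IsHalfIntegralBasis D m b) (r s : ℤ) :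
    Algebra.norm ℤ ((r : 𝓞 K) + s * b 1) = r ^ 2 + r * s + m * s ^ 2 := by
  rw [Algebra.norm_eq_matrix_det b, h.leftMulMatrix_eq, Matrix.det_fin_two_of]
  ring

omit [NumberField K] in
lemma trace_add_mul (h : IsHalfIntegralBasis D m b) (r s : ℤ) :
    Algebra.trace ℤ (𝓞 K) ((r : 𝓞 K) + s * b 1) = 2 * r + s := by
  rw [Algebra.trace_eq_matrix_trace b, h.leftMulMatrix_eq, Matrix.trace_fin_two_of]
  ring

lemma discr_eq (h : IsHalfIntegralBasis D m b) : discr K = -D := by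
  have h11 : b 1 * b 1 = ((-m : ℤ) : 𝓞 K) + (1 : ℤ) * b 1 := by
    rw [h.one_mul_one]; push_cast; ring
  have h1 := h.trace_add_mul 0 1
  have h2 := h.trace_add_mul (-m) 1
  have h3 := h.trace_add_mul 1 0
  rw [← h11] at h2
  simp only [Int.cast_zero, Int.cast_one, one_mul, zero_mul, zero_add, add_zero] at h1 h3
  rw [← NumberField.discr_eq_discr K b, Algebra.discr_def, Matrix.det_fin_two]
  simp only [Algebra.traceMatrix_apply, Algebra.traceForm_apply, h.zero_eq_one, one_mul, mul_one,
    h1, h2, h3]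
  have := h.add_one_eq
  push_cast
  omega

lemma embedding_omega (h : IsHalfIntegralBasis D m b) (σ : K →+* ℂ) :
    (σ (b 1 : K)).re = 1 / 2 ∧ (σ (b 1 : K)).im ^ 2 = D / 4 := by
  have hw : σ (b 1 : K) * σ (b 1 : K) = σ (b 1 : K) - m := by
    have := congrArg (fun x : 𝓞 K ↦ σ (x : K)) h.one_mul_one
    simpa using this
  set w := σ (b 1 : K)
  have hre := congrArg Complex.re hw
  have him := congrArg Complex.im hw
  simp only [Complex.mul_re, Complex.mul_im, Complex.sub_re, Complex.sub_im, Complex.natCast_re,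
    Complex.natCast_im] at hre him
  have hm : (D : ℝ) + 1 = 4 * m := by exact_mod_cast h.add_one_eq
  have hD : (0 : ℝ) ≤ D := by positivity
  have hm0 : (1 : ℝ) ≤ m := by
    have := h.add_one_eq
    exact_mod_cast (by omega : 1 ≤ m)
  have hw : w.im ≠ 0 := by
    intro h0
    rw [h0] at hre
    nlinarith [sq_nonneg (w.re - 1 / 2)]
  have hre2 : w.re = 1 / 2 := by
    have : w.im * (2 * w.re - 1) = 0 := by linarith
    have := (mul_eq_zero.1 this).resolve_left hw
    linarith
  refine ⟨hre2, ?_⟩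
  rw [hre2] at hre
  linarith

lemma norm_embedding_sq (h : IsHalfIntegralBasis D m b) (σ : K →+* ℂ) (x : 𝓞 K) :
    ‖σ (x : K)‖ ^ 2 = Ideal.absNorm (Ideal.span {x}) := by
  obtain ⟨hre, him⟩ := h.embedding_omega σ
  have hm : (D : ℝ) + 1 = 4 * m := by exact_mod_cast h.add_one_eq
  obtain ⟨r, s, rfl⟩ : ∃ r s : ℤ, x = (r : 𝓞 K) + s * b 1 := ⟨_, _, h.eq_add_mul x⟩
  have hn := h.norm_add_mul r s
  have hs : ‖σ (((r : 𝓞 K) + s * b 1 : 𝓞 K) : K)‖ ^ 2 = (r : ℝ) ^ 2 + r * s + m * s ^ 2 := by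
    rw [← Complex.normSq_eq_norm_sq, Complex.normSq_apply]
    simp only [map_add, map_mul, map_intCast, Complex.add_re, Complex.add_im, Complex.mul_re,
      Complex.mul_im, Complex.intCast_re, Complex.intCast_im, hre]
    linear_combination (s : ℝ) ^ 2 * him + s ^ 2 / 4 * hm
  have hnn : 0 ≤ Algebra.norm ℤ ((r : 𝓞 K) + s * b 1) := by
    rw [hn]
    have : (0 : ℝ) ≤ (r : ℝ) ^ 2 + r * s + m * s ^ 2 := hs ▸ sq_nonneg _
    exact_mod_cast this
  rw [Ideal.absNorm_span_singleton, hs, Nat.cast_natAbs, abs_of_nonneg hnn, hn]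
  push_cast
  ring

omit [NumberField K] in
lemma isUnit_iff (h : IsHalfIntegralBasis D m b) (hD : 4 < D) (x : 𝓞 K) :
    IsUnit x ↔ x = 1 ∨ x = -1 := by
  refine ⟨fun hx ↦ ?_, ?_⟩
  · obtain ⟨r, s, rfl⟩ : ∃ r s : ℤ, x = (r : 𝓞 K) + s * b 1 := ⟨_, _, h.eq_add_mul x⟩
    have hn := Int.isUnit_iff.1 (hx.map (Algebra.norm ℤ))
    rw [h.norm_add_mul] at hn
    have hm : (D : ℤ) + 1 = 4 * m := by exact_mod_cast h.add_one_eq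
    have hD' : (4 : ℤ) < D := by exact_mod_cast hD
    have h4 : (2 * r + s) ^ 2 + D * s ^ 2 ≤ 4 := by
      have : (2 * r + s) ^ 2 + D * s ^ 2 = 4 * (r ^ 2 + r * s + m * s ^ 2) := by
        linear_combination s ^ 2 * hm
      rcases hn with hn | hn <;> rw [this, hn] <;> norm_num
    have hs : s = 0 := by
      by_contra hs
      have : 0 < s ^ 2 := by positivity
      nlinarith [sq_nonneg (2 * r + s)]
    subst hs
    have hr : r = 1 ∨ r = -1 := by
      have hr1 : r ^ 2 = 1 := by
        rcases hn with hn | hn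
        · linarith
        · nlinarith [sq_nonneg r]
      have : (r - 1) * (r + 1) = 0 := by linear_combination hr1
      rcases mul_eq_zero.1 this with h | h
      · exact Or.inl (by linarith)
      · exact Or.inr (by linarith)
    rcases hr with rfl | rfl <;> simp
  · rintro (rfl | rfl) <;> simp

lemma card_units (h : IsHalfIntegralBasis D m b) (hD : 4 < D) : Nat.card (𝓞 K)ˣ = 2 := by
  have h1 : (Set.univ : Set (𝓞 K)ˣ) = {1, -1} := by
    ext u
    have := (h.isUnit_iff hD (u : 𝓞 K)).1 u.isUnit
    simp only [Set.mem_univ, Set.mem_insert_iff, Set.mem_singleton_iff, true_iff]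
    exact this.imp (fun h ↦ Units.ext h) (fun h ↦ Units.ext h)
  rw [← Set.ncard_univ, h1, Set.ncard_pair]
  intro h2
  have h3 := congrArg (fun u : (𝓞 K)ˣ ↦ (u : 𝓞 K)) h2
  simp only [Units.val_one, Units.val_neg] at h3
  have : (2 : 𝓞 K) = 0 := by linear_combination h3
  exact two_ne_zero this

lemma torsionOrder_eq (h : IsHalfIntegralBasis D m b) (hD : 4 < D) :
    Units.torsionOrder K = 2 := by
  have h2 := h.card_units hD
  have : Finite (𝓞 K)ˣ := Nat.finite_of_card_ne_zero (by omega)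
  have h1 : Units.torsion K = ⊤ := by
    rw [eq_top_iff]
    intro u _
    exact isOfFinOrder_of_finite u
  rw [Units.torsionOrder, h1, Subgroup.card_top, h2]

lemma isTotallyComplex (h : IsHalfIntegralBasis D m b) (hD : 0 < D) : IsTotallyComplex K := by
  refine ⟨fun v ↦ ?_⟩
  rw [← InfinitePlace.not_isReal_iff_isComplex]
  intro hv
  obtain ⟨σ, hσ, -⟩ := hv
  obtain ⟨-, him⟩ := h.embedding_omega σ
  have hc : (σ (b 1 : K)).im = 0 := by
    rw [← Complex.conj_eq_iff_im, ← ComplexEmbedding.conjugate_coe_eq]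
    rw [ComplexEmbedding.isReal_iff.1 hσ]
  rw [hc] at him
  have : (0 : ℝ) < D := by exact_mod_cast hD
  linarith

lemma dedekindZeta_residue_eq (h : IsHalfIntegralBasis D m b) (hD : 4 < D) :
    dedekindZeta_residue K = Real.pi * classNumber K / Real.sqrt D := by
  have := h.isTotallyComplex (by omega)
  have hr : InfinitePlace.nrRealPlaces K = 0 := IsTotallyComplex.nrRealPlaces_eq_zero K
  have hfin : Module.finrank ℚ K = 2 := by
    rw [← RingOfIntegers.rank, Module.finrank_eq_card_basis b, Fintype.card_fin]
  have hc : InfinitePlace.nrComplexPlaces K = 1 := by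
    have := IsTotallyComplex.finrank K
    omega
  have hreg : Units.regulator K = 1 := by
    have hrank : Units.rank K = 0 := by
      rw [Units.rank, InfinitePlace.card_eq_nrRealPlaces_add_nrComplexPlaces, hr, hc]
    have : IsEmpty {w : InfinitePlace K // w ≠ Units.dirichletUnitTheorem.w₀} :=
      (Units.equivFinRank (K := K)).symm.isEmpty_congr.2 (by rw [hrank]; infer_instance)
    rw [Units.regulator_eq_det', Matrix.det_isEmpty, abs_one]
  rw [dedekindZeta_residue_def, hr, hc, hreg, h.torsionOrder_eq hD, h.discr_eq]
  have : |((-(D : ℤ) : ℤ) : ℝ)| = D := by simp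
  rw [this]
  have : (0 : ℝ) < Real.sqrt D := Real.sqrt_pos.2 (by exact_mod_cast (by omega : 0 < D))
  push_cast
  field_simp

end IsHalfIntegralBasis

end QuadraticInvariants

section ClassLattice

variable {K : Type} [Field K] [NumberField K] {D m : ℕ}

/-- The nonzero integral ideals in a given ideal class. -/
abbrev IdealsInClass (K : Type) [Field K] [NumberField K] (C : ClassGroup (𝓞 K)) : Type :=
  {I : Ideal (𝓞 K) // I ≠ 0 ∧ idealClass K I = C}

lemma idealClass_of_ne_zero {I : Ideal (𝓞 K)} (hI : I ≠ 0) :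
    idealClass K I = ClassGroup.mk0 ⟨I, mem_nonZeroDivisors_of_ne_zero hI⟩ :=
  dif_pos _

lemma idealClass_mul {I J : Ideal (𝓞 K)} (hI : I ≠ 0) (hJ : J ≠ 0) :
    idealClass K (I * J) = idealClass K I * idealClass K J := by
  rw [idealClass_of_ne_zero hI, idealClass_of_ne_zero hJ, idealClass_of_ne_zero (mul_ne_zero hI hJ),
    ← map_mul]
  rfl

lemma idealClass_eq_one_iff {I : Ideal (𝓞 K)} (hI : I ≠ 0) :
    idealClass K I = 1 ↔ ∃ g, I = Ideal.span {g} := by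
  rw [idealClass_of_ne_zero hI, ClassGroup.mk0_eq_one_iff]
  exact ⟨fun h ↦ h.principal, fun h ↦ ⟨h⟩⟩

lemma exists_idealClass_eq (C : ClassGroup (𝓞 K)) :
    ∃ J : Ideal (𝓞 K), J ≠ 0 ∧ idealClass K J = C := by
  obtain ⟨J, rfl⟩ := ClassGroup.mk0_surjective C
  have hJ : (J : Ideal (𝓞 K)) ≠ 0 := nonZeroDivisors.coe_ne_zero J
  exact ⟨J, hJ, idealClass_of_ne_zero hJ⟩

/-- For `J` in the class inverse to `C`, the ideals `I` in `C` together with a unit parametrize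
the nonzero elements of `J`, through the generators of `I * J`. -/
lemma exists_equiv_idealsInClass_prod_units {C : ClassGroup (𝓞 K)} {J : Ideal (𝓞 K)}
    (hJ0 : J ≠ 0) (hJ : idealClass K J = C⁻¹) :
    ∃ e : IdealsInClass K C × (𝓞 K)ˣ ≃ {g : J // g ≠ 0},
      ∀ p, Ideal.span {((e p : J) : 𝓞 K)} = p.1.1 * J := by
  have hgen : ∀ I : IdealsInClass K C, ∃ g : 𝓞 K, I.1 * J = Ideal.span {g} := fun I ↦ by
    rw [← idealClass_eq_one_iff (mul_ne_zero I.2.1 hJ0), idealClass_mul I.2.1 hJ0, I.2.2, hJ,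
      mul_inv_cancel]
  choose g hg using hgen
  have hgJ : ∀ I, g I ∈ J := fun I ↦ Ideal.mul_le_right (I := I.1) (J := J) (by
    rw [hg I]; exact Ideal.mem_span_singleton_self _)
  have hg0 : ∀ I, g I ≠ 0 := fun I h0 ↦ mul_ne_zero I.2.1 hJ0 (by
    rw [hg I, h0, Ideal.span_singleton_zero]; rfl)
  let f : IdealsInClass K C × (𝓞 K)ˣ → {g : J // g ≠ 0} := fun p ↦
    ⟨⟨p.2 * g p.1, J.mul_mem_left _ (hgJ p.1)⟩, fun h ↦
      mul_ne_zero p.2.ne_zero (hg0 p.1) (congrArg Subtype.val h)⟩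
  have hspan : ∀ p, Ideal.span {((f p : J) : 𝓞 K)} = p.1.1 * J := fun p ↦ by
    change Ideal.span {(p.2 : 𝓞 K) * g p.1} = _
    rw [Ideal.span_singleton_mul_left_unit p.2.isUnit, hg]
  have hinj : Function.Injective f := by
    intro p q hpq
    have h1 : p.1.1 = q.1.1 := by
      refine mul_right_cancel₀ hJ0 ?_
      rw [← hspan, ← hspan, hpq]
    have h2 : p.1 = q.1 := Subtype.ext h1
    have h3 : (p.2 : 𝓞 K) * g p.1 = q.2 * g q.1 :=
      congrArg (fun x : {g : J // g ≠ 0} ↦ ((x : J) : 𝓞 K)) hpq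
    rw [h2] at h3
    exact Prod.ext h2 (Units.ext (mul_right_cancel₀ (hg0 _) h3))
  have hsurj : Function.Surjective f := by
    rintro ⟨⟨x, hx⟩, hx0⟩
    have hx0' : x ≠ 0 := fun h ↦ hx0 (Subtype.ext h)
    obtain ⟨I, hI⟩ := Ideal.dvd_span_singleton.2 hx
    have hI0 : I ≠ 0 := by
      rintro rfl
      rw [mul_zero, Ideal.zero_eq_bot, Ideal.span_singleton_eq_bot] at hI
      exact hx0' hI
    have hIC : idealClass K I = C := by
      have := (idealClass_eq_one_iff (mul_ne_zero hJ0 hI0)).2 ⟨x, hI.symm⟩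
      rw [idealClass_mul hJ0 hI0, hJ, inv_mul_eq_one] at this
      exact this.symm
    have hass : Associated (g ⟨I, hI0, hIC⟩) x := by
      rw [← Ideal.span_singleton_eq_span_singleton, ← hg, hI, mul_comm]
    obtain ⟨u, hu⟩ := hass
    refine ⟨(⟨I, hI0, hIC⟩, u), Subtype.ext (Subtype.ext ?_)⟩
    change (u : 𝓞 K) * g _ = x
    rw [← hu, mul_comm]
  exact ⟨Equiv.ofBijective f ⟨hinj, hsurj⟩, hspan⟩

namespace IsHalfIntegralBasis

variable {b : Module.Basis (Fin 2) ℤ (𝓞 K)}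

lemma abs_im_conj_mul (h : IsHalfIntegralBasis D m b) (σ : K →+* ℂ) (r₁ s₁ r₂ s₂ : ℤ) :
    |(starRingEnd ℂ (σ (((r₁ : 𝓞 K) + s₁ * b 1 : 𝓞 K) : K)) *
        σ (((r₂ : 𝓞 K) + s₂ * b 1 : 𝓞 K) : K)).im| =
      |((r₁ * s₂ - r₂ * s₁ : ℤ) : ℝ)| * (Real.sqrt D / 2) := by
  obtain ⟨hre, him⟩ := h.embedding_omega σ
  have hw : |(σ (b 1 : K)).im| = Real.sqrt D / 2 := by
    rw [← Real.sqrt_sq_eq_abs, him, Real.sqrt_div (by positivity),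
      show (4 : ℝ) = 2 ^ 2 by norm_num, Real.sqrt_sq (by norm_num)]
  rw [← hw, ← abs_mul]
  congr 1
  simp only [map_add, map_mul, map_intCast, Complex.add_re, Complex.add_im, Complex.mul_re,
    Complex.mul_im, Complex.intCast_re, Complex.intCast_im, Complex.conj_re, Complex.conj_im]
  push_cast
  ring

/-- The ideals of a class, counted with units, are parametrized by the nonzero vectors of a lattice
of covolume `√D / 2`, the norm of the ideal being the squared length of the vector. -/
lemma exists_lattice_equiv (h : IsHalfIntegralBasis D m b) (C : ClassGroup (𝓞 K)) :
    ∃ (z₁ z₂ : ℂ) (e : IdealsInClass K C × (𝓞 K)ˣ ≃ {v : ℤ × ℤ // v ≠ 0}),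
      |(starRingEnd ℂ z₁ * z₂).im| = Real.sqrt D / 2 ∧
      ∀ p, ‖((e p).1.1 : ℂ) * z₁ + ((e p).1.2 : ℂ) * z₂‖ ^ 2 = Ideal.absNorm p.1.1 := by
  obtain ⟨J, hJ0, hJ⟩ := exists_idealClass_eq C⁻¹
  obtain ⟨e, he⟩ := exists_equiv_idealsInClass_prod_units hJ0 hJ
  obtain ⟨σ⟩ : Nonempty (K →+* ℂ) := inferInstance
  set c := Ideal.selfBasis b J hJ0 with hc
  have hN : 0 < Ideal.absNorm J := Nat.pos_of_ne_zero fun h0 ↦ hJ0 (Ideal.absNorm_eq_zero_iff.1 h0)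
  have hN' : (0 : ℝ) < Real.sqrt (Ideal.absNorm J) := Real.sqrt_pos.2 (by exact_mod_cast hN)
  let N : ℂ := (Real.sqrt (Ideal.absNorm J) : ℝ)
  have hNn : ‖N‖ ^ 2 = Ideal.absNorm J := by
    rw [Complex.norm_real, Real.norm_of_nonneg hN'.le, Real.sq_sqrt (by positivity)]
  let e' : J ≃ ℤ × ℤ := c.equivFun.toEquiv.trans (finTwoArrowEquiv ℤ)
  have he'0 : e' 0 = 0 := by simp [e']
  have hval : ∀ g : J, (((e' g).1 : 𝓞 K) * (c 0 : J) + ((e' g).2 : 𝓞 K) * (c 1 : J)) = g := by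
    intro g
    have h1 : ((∑ i, c.equivFun g i • c i : J) : 𝓞 K) = g := by rw [c.sum_equivFun g]
    rw [← h1, Fin.sum_univ_two]
    simp [e']
  let e₂ : {g : J // g ≠ 0} ≃ {v : ℤ × ℤ // v ≠ 0} :=
    e'.subtypeEquiv fun g ↦ by rw [← he'0, e'.injective.ne_iff]
  refine ⟨σ ((c 0 : J) : 𝓞 K) / N, σ ((c 1 : J) : 𝓞 K) / N, e.trans e₂, ?_, fun p ↦ ?_⟩
  · have hdet := Ideal.natAbs_det_basis_change b J c
    rw [Module.Basis.det_apply, Matrix.det_fin_two] at hdet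
    simp only [Module.Basis.toMatrix_apply, Function.comp_apply] at hdet
    have h1 := h.abs_im_conj_mul σ (b.repr (c 0 : J) 0) (b.repr (c 0 : J) 1)
      (b.repr (c 1 : J) 0) (b.repr (c 1 : J) 1)
    rw [← h.eq_add_mul, ← h.eq_add_mul] at h1
    have h2 : starRingEnd ℂ (σ ((c 0 : J) : 𝓞 K) / N) * (σ ((c 1 : J) : 𝓞 K) / N) =
        (starRingEnd ℂ (σ ((c 0 : J) : 𝓞 K)) * σ ((c 1 : J) : 𝓞 K)) /
          ((Ideal.absNorm J : ℝ) : ℂ) := by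
      rw [← hNn, map_div₀, ← Complex.normSq_eq_norm_sq, Complex.normSq_eq_conj_mul_self]
      field_simp
    rw [h2, Complex.div_ofReal_im, abs_div, h1, ← Int.cast_abs, Int.abs_eq_natAbs, hdet]
    have : (Ideal.absNorm J : ℝ) ≠ 0 := by exact_mod_cast hN.ne'
    simp only [Int.cast_natCast, Nat.abs_cast]
    field_simp
  · have h1 := h.norm_embedding_sq σ ((e p : J) : 𝓞 K)
    rw [he, map_mul, ← hval (e p : J)] at h1
    have h2 : (((e.trans e₂) p).1.1 : ℂ) * (σ ((c 0 : J) : 𝓞 K) / N) +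
        (((e.trans e₂) p).1.2 : ℂ) * (σ ((c 1 : J) : 𝓞 K) / N) =
        (((e' (e p)).1 : ℂ) * σ ((c 0 : J) : 𝓞 K) +
          ((e' (e p)).2 : ℂ) * σ ((c 1 : J) : 𝓞 K)) / N := by
      change ((e' (e p)).1 : ℂ) * _ + ((e' (e p)).2 : ℂ) * _ = _
      ring
    rw [h2, norm_div, div_pow, hNn]
    simp only [map_add, map_mul, map_intCast] at h1
    rw [h1]
    have : (Ideal.absNorm J : ℝ) ≠ 0 := by exact_mod_cast hN.ne'
    push_cast
    field_simp

/-- Sums over an ideal class as sums over a lattice of covolume `√D / 2`. -/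
lemma exists_lattice_tsum (h : IsHalfIntegralBasis D m b) (hD : 4 < D) (C : ClassGroup (𝓞 K)) :
    ∃ z₁ z₂ : ℂ, |(starRingEnd ℂ z₁ * z₂).im| = Real.sqrt D / 2 ∧
      ∀ F : ℝ → ℝ, F 0 = 0 →
        (Summable fun I : IdealsInClass K C ↦ F (Ideal.absNorm I.1)) →
        HasSum (fun v : ℤ × ℤ ↦ F (‖(v.1 : ℂ) * z₁ + v.2 * z₂‖ ^ 2))
          (2 * ∑' I : IdealsInClass K C, F (Ideal.absNorm I.1)) := by
  obtain ⟨z₁, z₂, e, him, he⟩ := h.exists_lattice_equiv C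
  refine ⟨z₁, z₂, him, fun F hF0 hF ↦ ?_⟩
  have hcard := h.card_units hD
  have : Finite (𝓞 K)ˣ := Nat.finite_of_card_ne_zero (by omega)
  have : Fintype (𝓞 K)ˣ := Fintype.ofFinite _
  have hs : HasSum (fun p : IdealsInClass K C × (𝓞 K)ˣ ↦ F (Ideal.absNorm p.1.1))
      (2 * ∑' I : IdealsInClass K C, F (Ideal.absNorm I.1)) := by
    have h1 : Summable fun u : (𝓞 K)ˣ ↦ ‖(1 : ℝ)‖ := (hasSum_fintype _).summable
    have h2 := tsum_mul_tsum_of_summable_norm hF.norm h1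
    have h3 := (summable_mul_of_summable_norm hF.norm h1).hasSum
    rw [← h2] at h3
    simp only [mul_one] at h3
    rw [tsum_fintype (fun _ : (𝓞 K)ˣ ↦ (1 : ℝ))] at h3
    simp only [Finset.sum_const, Finset.card_univ, nsmul_eq_mul, mul_one] at h3
    rw [← Nat.card_eq_fintype_card, hcard, mul_comm] at h3
    exact_mod_cast h3
  rw [← hasSum_subtype_iff_of_support_subset (s := {v | v ≠ 0})]
  · refine (e.hasSum_iff (f := (fun v : ℤ × ℤ ↦ F (‖(v.1 : ℂ) * z₁ + v.2 * z₂‖ ^ 2)) ∘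
      Subtype.val)).1 ?_
    convert hs using 2 with p
    exact congrArg F (he p)
  · intro v hv h0
    apply hv
    simp [h0, hF0]

end IsHalfIntegralBasis

end ClassLattice

section IdealCount

variable {K : Type} [Field K] [NumberField K] {D m : ℕ}

lemma sup_eq_top_of_coprime {a c : ℕ} (hac : a.Coprime c) {I J : Ideal (𝓞 K)}
    (ha : (a : 𝓞 K) ∈ I) (hc : (c : 𝓞 K) ∈ J) : I ⊔ J = ⊤ := by
  obtain ⟨u, v, huv⟩ := Nat.isCoprime_iff_coprime.2 hac
  rw [Ideal.eq_top_iff_one, Submodule.mem_sup]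
  refine ⟨u * a, I.mul_mem_left _ ha, v * c, J.mul_mem_left _ hc, ?_⟩
  exact_mod_cast congrArg (Int.cast : ℤ → 𝓞 K) huv

lemma mul_sup_span_absNorm {I J : Ideal (𝓞 K)}
    (h : (Ideal.absNorm I).Coprime (Ideal.absNorm J)) :
    I * J ⊔ Ideal.span {(Ideal.absNorm I : 𝓞 K)} = I := by
  apply le_antisymm
  · exact sup_le Ideal.mul_le_left (Ideal.span_singleton_absNorm_le I)
  · have h1 : J ⊔ Ideal.span {(Ideal.absNorm I : 𝓞 K)} = ⊤ :=
      sup_eq_top_of_coprime h.symm (Ideal.absNorm_mem J) (Ideal.mem_span_singleton_self _)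
    calc I = I * (J ⊔ Ideal.span {(Ideal.absNorm I : 𝓞 K)}) := by rw [h1, Ideal.mul_top]
      _ = I * J ⊔ I * Ideal.span {(Ideal.absNorm I : 𝓞 K)} := Ideal.mul_sup _ _ _
      _ ≤ _ := sup_le_sup_left Ideal.mul_le_right _

lemma exists_mul_eq_of_absNorm_eq_mul (hfin : Module.finrank ℚ K = 2) {a c : ℕ} (ha : 0 < a)
    (hc : 0 < c) (hac : a.Coprime c) {A : Ideal (𝓞 K)} (hA : Ideal.absNorm A = a * c) :
    ∃ I J : Ideal (𝓞 K), Ideal.absNorm I = a ∧ Ideal.absNorm J = c ∧ I * J = A := by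
  set I := A ⊔ Ideal.span {(a : 𝓞 K)}
  set J := A ⊔ Ideal.span {(c : 𝓞 K)}
  have hIJ : I * J = A := by
    apply le_antisymm
    · rw [Ideal.sup_mul, Ideal.mul_sup (I := Ideal.span _), Ideal.span_singleton_mul_span_singleton]
      refine sup_le Ideal.mul_le_left (sup_le Ideal.mul_le_right ?_)
      rw [Ideal.span_singleton_le_iff_mem]
      have := Ideal.absNorm_mem A
      rw [hA] at this
      exact_mod_cast this
    · have h1 : Ideal.span {(a : 𝓞 K)} ⊔ Ideal.span {(c : 𝓞 K)} = ⊤ :=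
        sup_eq_top_of_coprime hac (Ideal.mem_span_singleton_self _)
          (Ideal.mem_span_singleton_self _)
      calc A = A * (Ideal.span {(a : 𝓞 K)} ⊔ Ideal.span {(c : 𝓞 K)}) := by rw [h1, Ideal.mul_top]
        _ = A * Ideal.span {(a : 𝓞 K)} ⊔ A * Ideal.span {(c : 𝓞 K)} := Ideal.mul_sup _ _ _
        _ ≤ _ := by
          refine sup_le ?_ ?_
          · rw [mul_comm]; exact Ideal.mul_mono le_sup_right le_sup_left
          · exact Ideal.mul_mono le_sup_left le_sup_right
  have hdvd : ∀ n : ℕ, ∀ n' : ℕ, n.Coprime n' → Ideal.absNorm A = n * n' →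
      Ideal.absNorm (A ⊔ Ideal.span {(n : 𝓞 K)}) ∣ n := by
    intro n n' hn hAn
    have h1 : Ideal.absNorm (A ⊔ Ideal.span {(n : 𝓞 K)}) ∣ n * n' :=
      hAn ▸ Ideal.absNorm_dvd_absNorm_of_le le_sup_left
    have h2 : Ideal.absNorm (A ⊔ Ideal.span {(n : 𝓞 K)}) ∣ n * n := by
      have := Ideal.absNorm_dvd_absNorm_of_le
        (le_sup_right : Ideal.span {(n : 𝓞 K)} ≤ A ⊔ Ideal.span {(n : 𝓞 K)})
      rwa [Ideal.absNorm_span_natCast, RingOfIntegers.rank, hfin, sq] at this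
    have h3 := Nat.dvd_gcd h1 h2
    rwa [Nat.gcd_mul_left, hn.symm.gcd_eq_one, mul_one] at h3
  have hI : Ideal.absNorm I ∣ a := hdvd a c hac hA
  have hJ : Ideal.absNorm J ∣ c := hdvd c a hac.symm (by rw [hA, mul_comm])
  have hm : Ideal.absNorm I * Ideal.absNorm J = a * c := by rw [← map_mul, hIJ, hA]
  have hIa := Nat.le_of_dvd ha hI
  have hJc := Nat.le_of_dvd hc hJ
  have hIa' : Ideal.absNorm I = a := by
    by_contra hne
    have : Ideal.absNorm I * Ideal.absNorm J < a * c :=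
      Nat.mul_lt_mul_of_lt_of_le (lt_of_le_of_ne hIa hne) hJc hc
    omega
  refine ⟨I, J, hIa', ?_, hIJ⟩
  rw [hIa'] at hm
  exact Nat.eq_of_mul_eq_mul_left ha hm

/-- The number of integral ideals of norm `n`. -/
noncomputable def idealCount (K : Type) [Field K] [NumberField K] (n : ℕ) : ℕ :=
  Nat.card {I : Ideal (𝓞 K) // Ideal.absNorm I = n}

lemma idealCount_one : idealCount K 1 = 1 := by
  have : Unique {I : Ideal (𝓞 K) // Ideal.absNorm I = 1} :=
    ⟨⟨⟨⊤, Ideal.absNorm_top⟩⟩, fun I ↦ Subtype.ext (Ideal.absNorm_eq_one_iff.1 I.2)⟩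
  exact Nat.card_unique

lemma idealCount_mul (hfin : Module.finrank ℚ K = 2) {a c : ℕ} (ha : 0 < a)
    (hc : 0 < c) (hac : a.Coprime c) : idealCount K (a * c) = idealCount K a * idealCount K c := by
  rw [idealCount, idealCount, idealCount, ← Nat.card_prod]
  symm
  refine Nat.card_congr (Equiv.ofBijective
    (fun p ↦ ⟨p.1.1 * p.2.1, by rw [map_mul, p.1.2, p.2.2]⟩) ⟨?_, ?_⟩)
  · rintro ⟨⟨I, hI⟩, J, hJ⟩ ⟨⟨I', hI'⟩, J', hJ'⟩ h
    have h1 : I * J = I' * J' := congrArg Subtype.val h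
    have h2 := mul_sup_span_absNorm (I := I) (J := J) (by rwa [hI, hJ])
    have h3 := mul_sup_span_absNorm (I := I') (J := J') (by rwa [hI', hJ'])
    have hII : I = I' := by rw [← h2, ← h3, h1, hI, hI']
    have h4 := mul_sup_span_absNorm (I := J) (J := I) (by rw [hI, hJ]; exact hac.symm)
    have h5 := mul_sup_span_absNorm (I := J') (J := I') (by rw [hI', hJ']; exact hac.symm)
    have hJJ : J = J' := by rw [← h4, ← h5, mul_comm J, h1, mul_comm J', hJ, hJ']
    subst hII hJJ
    rfl
  · rintro ⟨A, hA⟩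
    obtain ⟨I, J, hI, hJ, hIJ⟩ := exists_mul_eq_of_absNorm_eq_mul hfin ha hc hac hA
    exact ⟨⟨⟨I, hI⟩, J, hJ⟩, Subtype.ext hIJ⟩

lemma idealCount_eq_card {n : ℕ} {s : Finset (Ideal (𝓞 K))}
    (hs : ∀ I, I ∈ s ↔ Ideal.absNorm I = n) : idealCount K n = s.card := by
  rw [idealCount, ← Fintype.card_coe, ← Nat.card_eq_fintype_card]
  exact Nat.card_congr (Equiv.subtypeEquivRight fun I ↦ (hs I).symm)

lemma idealCount_prime_pow_of_isPrime (hfin : Module.finrank ℚ K = 2) {p : ℕ} (hp : p.Prime)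
    (hP : (Ideal.span {(p : 𝓞 K)}).IsPrime) (k : ℕ) :
    idealCount K (p ^ k) = if Even k then 1 else 0 := by
  set P := Ideal.span {(p : 𝓞 K)}
  have hN : Ideal.absNorm P = p ^ 2 := by
    rw [Ideal.absNorm_span_natCast, RingOfIntegers.rank, hfin]
  have hP0 : P ≠ ⊥ := by
    intro h
    rw [h, Ideal.absNorm_bot] at hN
    exact (pow_pos hp.pos 2).ne hN
  have hPp := Ideal.prime_of_isPrime hP0 hP
  have hI : ∀ I : Ideal (𝓞 K), Ideal.absNorm I = p ^ k → ∃ j, k = 2 * j ∧ I = P ^ j := by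
    intro I hI
    have h1 : I ∣ P ^ k := by
      rw [Ideal.dvd_iff_le, Ideal.span_singleton_pow, Ideal.span_singleton_le_iff_mem]
      have := Ideal.absNorm_mem I
      rw [hI] at this
      exact_mod_cast this
    obtain ⟨j, -, hj⟩ := (dvd_prime_pow hPp k).1 h1
    rw [associated_iff_eq] at hj
    refine ⟨j, ?_, hj⟩
    rw [hj, map_pow, hN, ← pow_mul] at hI
    exact (Nat.pow_right_injective hp.two_le hI).symm
  split_ifs with hk
  · obtain ⟨j, hj⟩ := hk.two_dvd
    rw [idealCount_eq_card (s := {P ^ j}), Finset.card_singleton]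
    intro I
    rw [Finset.mem_singleton]
    constructor
    · rintro rfl; rw [map_pow, hN, ← pow_mul, hj]
    · intro h
      obtain ⟨i, hi, rfl⟩ := hI I h
      congr 1; omega
  · rw [idealCount_eq_card (s := ∅), Finset.card_empty]
    intro I
    simp only [Finset.notMem_empty, false_iff]
    intro h
    obtain ⟨i, hi, -⟩ := hI I h
    exact hk (hi ▸ even_two_mul i)

lemma exists_pow_mul_pow_eq_of_absNorm {p : ℕ} (hp : p.Prime) {P Q : Ideal (𝓞 K)}
    (hP : Ideal.absNorm P = p) (hQ : Ideal.absNorm Q = p)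
    (hPQ : P * Q = Ideal.span {(p : 𝓞 K)}) (k : ℕ) (I : Ideal (𝓞 K))
    (hI : Ideal.absNorm I = p ^ k) : ∃ i ≤ k, I = P ^ i * Q ^ (k - i) := by
  have hmax : ∀ R : Ideal (𝓞 K), Ideal.absNorm R = p → R.IsMaximal := by
    intro R hR
    have : R.IsPrime := Ideal.isPrime_of_irreducible_absNorm (hR ▸ hp)
    refine this.isMaximal fun h ↦ ?_
    rw [h, Ideal.absNorm_bot] at hR
    exact hp.pos.ne hR
  induction k generalizing I with
  | zero =>
    refine ⟨0, le_rfl, ?_⟩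
    rw [pow_zero, Ideal.absNorm_eq_one_iff] at hI
    simp [hI]
  | succ k ih =>
    have hI1 : I ≠ ⊤ := by
      rw [Ne, ← Ideal.absNorm_eq_one_iff, hI]
      exact (Nat.one_lt_pow (by omega) hp.one_lt).ne'
    obtain ⟨M, hM, hIM⟩ := Ideal.exists_le_maximal I hI1
    have hpM : (p : 𝓞 K) ∈ M := by
      have h1 := hIM (Ideal.absNorm_mem I)
      rw [hI, Nat.cast_pow] at h1
      exact hM.isPrime.mem_of_pow_mem _ h1
    have h2 : P * Q ≤ M := by rwa [hPQ, Ideal.span_singleton_le_iff_mem]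
    obtain ⟨J, rfl⟩ := Ideal.dvd_iff_le.2 hIM
    have key : ∀ R : Ideal (𝓞 K), Ideal.absNorm R = p → R ≤ M →
        M = R ∧ Ideal.absNorm J = p ^ k := by
      intro R hR hRM
      have hMR : M = R := ((hmax R hR).eq_of_le hM.ne_top hRM).symm
      refine ⟨hMR, ?_⟩
      rw [map_mul, hMR, hR, pow_succ'] at hI
      exact Nat.eq_of_mul_eq_mul_left hp.pos hI
    rcases hM.isPrime.mul_le.1 h2 with h3 | h3
    · obtain ⟨rfl, hJ⟩ := key P hP h3
      obtain ⟨i, hi, rfl⟩ := ih J hJ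
      refine ⟨i + 1, by omega, ?_⟩
      rw [pow_succ', mul_assoc, Nat.add_sub_add_right]
    · obtain ⟨rfl, hJ⟩ := key Q hQ h3
      obtain ⟨i, hi, rfl⟩ := ih J hJ
      refine ⟨i, by omega, ?_⟩
      rw [Nat.succ_sub hi, pow_succ']
      ring

/-- The number of ideals of norm a power of the prime `p` is governed by whether `p` is inert,
ramified or split. -/
lemma idealCount_prime_pow (hfin : Module.finrank ℚ K = 2) {p : ℕ} (hp : p.Prime) :
    (idealCount K p = 0 ∧ ∀ k, idealCount K (p ^ k) = if Even k then 1 else 0) ∨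
    (idealCount K p = 1 ∧ ∀ k, idealCount K (p ^ k) = 1) ∨
    (idealCount K p = 2 ∧ ∀ k, idealCount K (p ^ k) = k + 1) := by
  have hN : Ideal.absNorm (Ideal.span {(p : 𝓞 K)}) = p ^ 2 := by
    rw [Ideal.absNorm_span_natCast, RingOfIntegers.rank, hfin]
  have hne : Ideal.span {(p : 𝓞 K)} ≠ ⊤ := by
    rw [Ne, ← Ideal.absNorm_eq_one_iff, hN]
    exact (Nat.one_lt_pow (by omega) hp.one_lt).ne'
  obtain ⟨P, hPm, hpP⟩ := Ideal.exists_le_maximal _ hne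
  obtain ⟨Q, hPQ⟩ := Ideal.dvd_iff_le.2 hpP
  have hmul : Ideal.absNorm P * Ideal.absNorm Q = p ^ 2 := by rw [← map_mul, ← hPQ, hN]
  obtain ⟨j, hj, hPj⟩ := (Nat.dvd_prime_pow hp).1 (Dvd.intro _ hmul)
  interval_cases j
  · rw [pow_zero, Ideal.absNorm_eq_one_iff] at hPj
    exact absurd hPj hPm.ne_top
  · rw [pow_one] at hPj
    have hQ : Ideal.absNorm Q = p := by
      rw [hPj, sq] at hmul
      exact Nat.eq_of_mul_eq_mul_left hp.pos hmul
    have hfac := exists_pow_mul_pow_eq_of_absNorm hp hPj hQ hPQ.symm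
    have hmem : ∀ k I, I ∈ (Finset.range (k + 1)).image (fun i ↦ P ^ i * Q ^ (k - i)) ↔
        Ideal.absNorm I = p ^ k := by
      intro k I
      simp only [Finset.mem_image, Finset.mem_range]
      constructor
      · rintro ⟨i, hi, rfl⟩
        rw [map_mul, map_pow, map_pow, hPj, hQ, ← pow_add]
        congr 1; omega
      · intro h
        obtain ⟨i, hi, rfl⟩ := hfac k I h
        exact ⟨i, by omega, rfl⟩
    have hcard := fun k ↦ idealCount_eq_card (hmem k)
    have hP0 : P ≠ 0 := by
      rintro rfl
      rw [map_zero] at hPj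
      exact hp.pos.ne hPj
    by_cases hPQe : P = Q
    · have h1 : ∀ k, idealCount K (p ^ k) = 1 := by
        intro k
        rw [idealCount_eq_card (s := {P ^ k}), Finset.card_singleton]
        intro I
        rw [← hmem k, ← hPQe, Finset.mem_singleton, Finset.mem_image]
        constructor
        · rintro rfl; exact ⟨0, by simp, by simp⟩
        · rintro ⟨i, hi, rfl⟩
          rw [Finset.mem_range] at hi
          rw [← pow_add]; congr 1; omega
      exact Or.inr (Or.inl ⟨by simpa using h1 1, h1⟩)
    · have h1 : ∀ k, idealCount K (p ^ k) = k + 1 := by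
        intro k
        rw [hcard k, Finset.card_image_of_injOn, Finset.card_range]
        have hQmax : Q.IsPrime := Ideal.isPrime_of_irreducible_absNorm (hQ ▸ hp)
        have hlt : ∀ i j : ℕ, i < j → j ≤ k → P ^ i * Q ^ (k - i) ≠ P ^ j * Q ^ (k - j) := by
          intro i j hij hjk h
          obtain ⟨d, rfl⟩ := Nat.exists_eq_add_of_lt hij
          rw [add_assoc, pow_add, mul_assoc] at h
          have h2 := mul_left_cancel₀ (pow_ne_zero i hP0) h
          have h3 : P ∣ Q ^ (k - i) := by
            rw [h2, pow_succ', mul_assoc]; exact Dvd.intro _ rfl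
          have h4 := (Ideal.prime_of_isPrime hP0 hPm.isPrime).dvd_of_dvd_pow h3
          have hQ0 : Q ≠ ⊥ := by
            rintro rfl
            rw [Ideal.absNorm_bot] at hQ
            exact hp.pos.ne hQ
          exact hPQe ((hQmax.isMaximal hQ0).eq_of_le hPm.ne_top (Ideal.dvd_iff_le.1 h4)).symm
        intro i hi j hj hij
        simp only [Finset.coe_range, Set.mem_Iio] at hi hj
        rcases lt_trichotomy i j with h | h | h
        · exact absurd hij (hlt i j h (by omega))
        · exact h
        · exact absurd hij.symm (hlt j i h (by omega))
      exact Or.inr (Or.inr ⟨by simpa using h1 1, h1⟩)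
  · have hQ : Q = ⊤ := by
      rw [hPj] at hmul
      rw [← Ideal.absNorm_eq_one_iff]
      exact Nat.eq_of_mul_eq_mul_left (pow_pos hp.pos 2) (by rw [hmul, mul_one])
    rw [hQ, Ideal.mul_top] at hPQ
    have h1 := idealCount_prime_pow_of_isPrime hfin hp (hPQ ▸ hPm.isPrime)
    exact Or.inl ⟨by simpa using h1 1, h1⟩

end IdealCount

section PrimeNorm

variable {K : Type} [Field K] [NumberField K] {D m : ℕ}

namespace IsHalfIntegralBasis

variable {b : Module.Basis (Fin 2) ℤ (𝓞 K)}

omit [NumberField K] in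
lemma repr_add_mul (h : IsHalfIntegralBasis D m b) (r s : ℤ) :
    b.repr ((r : 𝓞 K) + s * b 1) 0 = r ∧ b.repr ((r : 𝓞 K) + s * b 1) 1 = s := by
  have : (r : 𝓞 K) + s * b 1 = r • b 0 + s • b 1 := by simp [h.zero_eq_one]
  rw [this]
  constructor <;> simp [-zsmul_eq_mul]

omit [NumberField K] in
/-- The ring homomorphism to a commutative ring sending `ω` to a root of `X² - X + m`. -/
lemma exists_ringHom (h : IsHalfIntegralBasis D m b) {R : Type} [CommRing R] {a : R}
    (ha : a * a = a - m) : ∃ f : 𝓞 K →+* R, f (b 1) = a := by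
  have hrepr : ∀ r s : ℤ, ∀ x, x = (r : 𝓞 K) + s * b 1 → b.repr x 0 = r ∧ b.repr x 1 = s := by
    rintro r s x rfl; exact h.repr_add_mul r s
  have h1 : b.repr 1 0 = 1 ∧ b.repr 1 1 = 0 := hrepr 1 0 1 (by simp)
  refine ⟨{ toFun := fun x ↦ (b.repr x 0 : R) + (b.repr x 1 : R) * a
            map_one' := by simp [h1]
            map_mul' := fun x y ↦ ?_
            map_zero' := by simp
            map_add' := fun x y ↦ by simp; ring }, ?_⟩
  · have hx := h.eq_add_mul x
    have hy := h.eq_add_mul y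
    set r := b.repr x 0
    set s := b.repr x 1
    set r' := b.repr y 0
    set s' := b.repr y 1
    have := hrepr (r * r' - m * (s * s')) (r * s' + r' * s + s * s') (x * y) (by
      rw [hx, hy]; push_cast; linear_combination (s * s' : 𝓞 K) * h.one_mul_one)
    rw [this.1, this.2]
    push_cast
    linear_combination -(s * s' : R) * ha
  · simp

lemma idealCount_prime_eq_card_roots (h : IsHalfIntegralBasis D m b) (p : ℕ) [Fact p.Prime] :
    idealCount K p = Nat.card {a : ZMod p // a * a = a - m} := by
  symm
  have hf := fun a : {a : ZMod p // a * a = a - m} ↦ h.exists_ringHom a.2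
  choose f hf using hf
  have hsurj : ∀ g : 𝓞 K →+* ZMod p, Function.Surjective g := fun g y ↦
    ⟨(y.val : 𝓞 K), by rw [map_natCast, ZMod.natCast_zmod_val]⟩
  have hker : ∀ g : 𝓞 K →+* ZMod p, Ideal.absNorm (RingHom.ker g) = p := by
    intro g
    have := Nat.card_congr (RingHom.quotientKerEquivOfSurjective (hsurj g)).toEquiv
    rw [Ideal.absNorm_apply, Submodule.cardQuot_apply]
    rw [Nat.card_zmod] at this
    exact this
  refine Nat.card_congr (Equiv.ofBijective (fun a ↦ ⟨RingHom.ker (f a), hker _⟩) ⟨?_, ?_⟩)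
  · intro a a' haa
    have h1 : RingHom.ker (f a) = RingHom.ker (f a') := congrArg Subtype.val haa
    have h2 : b 1 - (a.1.val : 𝓞 K) ∈ RingHom.ker (f a) := by
      rw [RingHom.mem_ker, map_sub, map_natCast, hf, ZMod.natCast_zmod_val, sub_self]
    rw [h1, RingHom.mem_ker, map_sub, map_natCast, hf, ZMod.natCast_zmod_val, sub_eq_zero] at h2
    exact Subtype.ext h2.symm
  · rintro ⟨I, hI⟩
    have hcard : Nat.card (𝓞 K ⧸ I) = p := by
      rw [← hI, Ideal.absNorm_apply, Submodule.cardQuot_apply]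
    have hfin : Finite (𝓞 K ⧸ I) :=
      Nat.finite_of_card_ne_zero (hcard ▸ (Fact.out : p.Prime).ne_zero)
    have : Fintype (𝓞 K ⧸ I) := Fintype.ofFinite _
    let e : ZMod p ≃+* 𝓞 K ⧸ I := ZMod.ringEquivOfPrime _ Fact.out (by
      rw [← Nat.card_eq_fintype_card, hcard])
    let g : 𝓞 K →+* ZMod p := (e.symm : (𝓞 K ⧸ I) →+* ZMod p).comp (Ideal.Quotient.mk I)
    have hg : RingHom.ker g = I := by
      ext x
      simp [g, RingHom.mem_ker, Ideal.Quotient.eq_zero_iff_mem]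
    have hroot : g (b 1) * g (b 1) = g (b 1) - m := by
      rw [← map_mul, h.one_mul_one, map_sub, map_natCast]
    refine ⟨⟨g (b 1), hroot⟩, Subtype.ext ?_⟩
    have hfg : f ⟨g (b 1), hroot⟩ = g := by
      ext x
      rw [h.eq_add_mul x]
      simp only [map_add, map_mul, map_intCast, hf]
    change RingHom.ker (f _) = I
    rw [hfg, hg]

end IsHalfIntegralBasis

lemma card_roots_eq_quadraticChar_add_one {p : ℕ} [Fact p.Prime] (hp2 : p ≠ 2)
    (hm : D + 1 = 4 * m) :
    (Nat.card {a : ZMod p // a * a = a - m} : ℤ) = quadraticChar (ZMod p) (-(D : ZMod p)) + 1 := by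
  have hchar : ringChar (ZMod p) ≠ 2 := by rwa [ZMod.ringChar_zmod_n]
  have h2 : (2 : ZMod p) ≠ 0 := Ring.two_ne_zero hchar
  have hmp : (D : ZMod p) + 1 = 4 * m := by exact_mod_cast congrArg (Nat.cast : ℕ → ZMod p) hm
  rw [← quadraticChar_card_sqrts hchar, Set.toFinset_card, ← Nat.card_eq_fintype_card]
  congr 1
  refine Nat.card_congr ⟨fun a ↦ ⟨2 * a.1 - 1, ?_⟩, fun c ↦ ⟨(c.1 + 1) / 2, ?_⟩, fun a ↦ ?_,
    fun c ↦ ?_⟩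
  · have := a.2
    change (2 * a.1 - 1) ^ 2 = -(D : ZMod p)
    linear_combination 4 * this + hmp
  · have : c.1 ^ 2 = -(D : ZMod p) := c.2
    field_simp
    linear_combination this - hmp
  · apply Subtype.ext; simp only; field_simp; ring
  · apply Subtype.ext; simp only; field_simp; ring

lemma quadraticChar_neg_eq [hD : Fact D.Prime] (hD4 : D % 4 = 3) {p : ℕ} [hp : Fact p.Prime]
    (hp2 : p ≠ 2) : quadraticChar (ZMod p) (-(D : ZMod p)) = quadraticChar (ZMod D) p := by
  have hD2 : D ≠ 2 := by rintro rfl; omega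
  by_cases hpD : p = D
  · subst hpD
    simp
  have h1 : quadraticChar (ZMod p) (-(D : ZMod p)) =
      quadraticChar (ZMod p) (-1) * legendreSym p D := by
    rw [legendreSym, ← map_mul]; simp
  have h2 : quadraticChar (ZMod D) p = legendreSym D p := by simp [legendreSym]
  have hneg : quadraticChar (ZMod p) (-1) = ZMod.χ₄ p := by
    rw [quadraticChar_neg_one (by rwa [ZMod.ringChar_zmod_n]), ZMod.card]
  rw [h1, h2, hneg]
  have hp4 : p % 4 = 1 ∨ p % 4 = 3 := by
    have := hp.out.eq_two_or_odd
    omega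
  rcases hp4 with hp4 | hp4
  · rw [ZMod.χ₄_nat_one_mod_four hp4, one_mul]
    exact (legendreSym.quadratic_reciprocity_one_mod_four hp4 hD2).symm
  · rw [ZMod.χ₄_nat_three_mod_four hp4, legendreSym.quadratic_reciprocity_three_mod_four hp4 hD4]
    ring

lemma card_roots_two [hD : Fact D.Prime] (hD4 : D % 4 = 3) (hm : D + 1 = 4 * m) :
    (Nat.card {a : ZMod 2 // a * a = a - m} : ℤ) = quadraticChar (ZMod D) 2 + 1 := by
  have hD2 : D ≠ 2 := by rintro rfl; omega
  have h8 : quadraticChar (ZMod D) 2 = ZMod.χ₈ D := by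
    rw [quadraticChar_two (by rwa [ZMod.ringChar_zmod_n]), ZMod.card]
  have hroot : ∀ a : ZMod 2, a * a = a - m ↔ (m : ZMod 2) = 0 := by
    intro a
    have : a * a = a := by revert a; decide
    rw [this, eq_comm, sub_eq_self]
  simp only [hroot]
  rw [h8, ZMod.χ₈_nat_eq_if_mod_eight, ZMod.natCast_eq_zero_iff]
  by_cases hm2 : 2 ∣ m
  · rw [if_neg (by omega), if_pos (by omega)]
    simp [hm2]
  · rw [if_neg (by omega), if_neg (by omega)]
    simp [hm2]

lemma IsHalfIntegralBasis.idealCount_prime [hD : Fact D.Prime]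
    {b : Module.Basis (Fin 2) ℤ (𝓞 K)} (h : IsHalfIntegralBasis D m b) {p : ℕ} (hp : p.Prime) :
    (idealCount K p : ℤ) = quadraticChar (ZMod D) p + 1 := by
  have hD4 : D % 4 = 3 := by have := h.add_one_eq; omega
  have := Fact.mk hp
  rw [h.idealCount_prime_eq_card_roots p]
  by_cases hp2 : p = 2
  · subst hp2
    exact_mod_cast card_roots_two hD4 h.add_one_eq
  · rw [card_roots_eq_quadraticChar_add_one hp2 h.add_one_eq, quadraticChar_neg_eq hD4 hp2]

end PrimeNorm

section DedekindZeta

open Filter Topology ArithmeticFunction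

variable {K : Type} [Field K] [NumberField K] {D m : ℕ}

lemma chiD_ne_one [Fact D.Prime] (hD : D ≠ 2) : chiD D ≠ 1 := by
  intro h
  obtain ⟨a, ha⟩ := quadraticChar_exists_neg_one (F := ZMod D) (by rwa [ZMod.ringChar_zmod_n])
  have ha0 : IsUnit a := by
    rw [isUnit_iff_ne_zero]; rintro rfl; simp at ha
  have := congrArg (fun f : MulChar (ZMod D) ℂ ↦ f a) h
  simp only [chiD, MulChar.ringHomComp_apply, ha, MulChar.one_apply ha0] at this
  norm_num at this

variable {b : Module.Basis (Fin 2) ℤ (𝓞 K)}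

lemma IsHalfIntegralBasis.idealCount_prime_pow_eq [Fact D.Prime] (h : IsHalfIntegralBasis D m b)
    (hfin : Module.finrank ℚ K = 2) {p : ℕ} (hp : p.Prime) (k : ℕ) :
    (idealCount K (p ^ k) : ℂ) = (chiD D).zetaMul (p ^ k) := by
  have hsum : (chiD D).zetaMul (p ^ k) = ∑ i ∈ Finset.range (k + 1), (chiD D p) ^ i := by
    rw [DirichletCharacter.zetaMul, coe_zeta_mul_apply, Nat.sum_divisors_prime_pow hp]
    refine Finset.sum_congr rfl fun i _ ↦ ?_
    simp [toArithmeticFunction, hp.ne_zero]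
  have hchi : (chiD D p) = (idealCount K p : ℂ) - 1 := by
    have := h.idealCount_prime hp
    have h2 : ((idealCount K p : ℤ) : ℂ) = ((quadraticChar (ZMod D) p + 1 : ℤ) : ℂ) := by
      rw [this]
    push_cast at h2
    rw [h2, add_sub_cancel_right]
    rfl
  rw [hsum, hchi]
  rcases idealCount_prime_pow (K := K) hfin hp with ⟨h1, h2⟩ | ⟨h1, h2⟩ | ⟨h1, h2⟩
  · rw [h1, h2, Nat.cast_zero, zero_sub, neg_one_geom_sum]
    by_cases hk : Even k <;> simp [hk, Nat.even_add_one]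
  · rw [h1, h2, Finset.sum_range_succ']
    simp
  · rw [h1, h2]
    norm_num

lemma IsHalfIntegralBasis.idealCount_eq_zetaMul [Fact D.Prime] (h : IsHalfIntegralBasis D m b)
    (hfin : Module.finrank ℚ K = 2) {n : ℕ} (hn : n ≠ 0) :
    (idealCount K n : ℂ) = (chiD D).zetaMul n := by
  set f : ArithmeticFunction ℂ := toArithmeticFunction fun n ↦ (idealCount K n : ℂ) with hf
  have hfn : ∀ {n : ℕ}, n ≠ 0 → f n = idealCount K n := fun hn ↦ by
    simp [hf, toArithmeticFunction, hn]
  have hfm : f.IsMultiplicative := by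
    rw [IsMultiplicative.iff_ne_zero]
    refine ⟨by rw [hfn one_ne_zero, idealCount_one, Nat.cast_one], fun {a c} ha hc hac ↦ ?_⟩
    rw [hfn ha, hfn hc, hfn (mul_ne_zero ha hc),
      idealCount_mul hfin (Nat.pos_of_ne_zero ha) (Nat.pos_of_ne_zero hc) hac, Nat.cast_mul]
  have : f = (chiD D).zetaMul := by
    rw [hfm.eq_iff_eq_on_prime_powers _ _ (chiD D).isMultiplicative_zetaMul]
    intro p k hp
    rw [hfn (pow_ne_zero _ hp.ne_zero), h.idealCount_prime_pow_eq hfin hp]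
  rw [← hfn hn, this]

/-- There are at most `n` ideals of norm `n ≠ 0`. -/
lemma IsHalfIntegralBasis.idealCount_le [Fact D.Prime] (h : IsHalfIntegralBasis D m b)
    (hfin : Module.finrank ℚ K = 2) {n : ℕ} (hn : n ≠ 0) : idealCount K n ≤ n := by
  have h1 : ‖(idealCount K n : ℂ)‖ ≤ n := by
    rw [h.idealCount_eq_zetaMul hfin hn, DirichletCharacter.zetaMul, coe_zeta_mul_apply]
    calc _ ≤ ∑ i ∈ n.divisors, (1 : ℝ) := by
          refine (norm_sum_le _ _).trans (Finset.sum_le_sum fun i hi ↦ ?_)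
          have : i ≠ 0 := (Nat.pos_of_mem_divisors hi).ne'
          simpa [toArithmeticFunction, this] using DirichletCharacter.norm_le_one _ _
      _ ≤ n := by simpa using Nat.card_divisors_le_self n
  rw [Complex.norm_natCast] at h1
  exact_mod_cast h1

lemma LSeries_zetaMul {N : ℕ} [NeZero N] (χ : DirichletCharacter ℂ N) {s : ℂ} (hs : 1 < s.re) :
    LSeries χ.zetaMul s = riemannZeta s * χ.LFunction s := by
  have hsum : LSeriesSummable (toArithmeticFunction (χ ·)) s :=
    LSeriesSummable_of_bounded_of_one_lt_re (m := 1) (fun n hn ↦ by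
      simpa [toArithmeticFunction, hn] using χ.norm_le_one _) hs
  have hζ : (fun n ↦ (zeta : ArithmeticFunction ℂ) n) =
      fun n ↦ ((zeta n : ℕ) : ℂ) := funext fun n ↦ natCoe_apply
  have h1 := LSeries_mul' (f := (zeta : ArithmeticFunction ℂ))
    (by rw [hζ]; exact LSeriesSummable_zeta_iff.mpr hs) hsum
  have h2 : LSeries (toArithmeticFunction (χ ·)) s = χ.LFunction s := by
    rw [DirichletCharacter.LFunction_eq_LSeries _ hs]
    exact LSeries_congr (fun {n} hn ↦ by simp [toArithmeticFunction, hn]) s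
  rw [h2, hζ, LSeries_zeta_eq_riemannZeta hs] at h1
  exact h1

lemma IsHalfIntegralBasis.dedekindZeta_eq [Fact D.Prime] (h : IsHalfIntegralBasis D m b)
    (hfin : Module.finrank ℚ K = 2) {s : ℂ} (hs : 1 < s.re) :
    dedekindZeta K s = riemannZeta s * (chiD D).LFunction s := by
  rw [← LSeries_zetaMul _ hs]
  exact LSeries_congr (fun {n} hn ↦ h.idealCount_eq_zetaMul hfin hn) s

/-- The class number formula for the imaginary quadratic field of discriminant `-D`. -/
lemma IsHalfIntegralBasis.LFunction_one_eq [Fact D.Prime] (h : IsHalfIntegralBasis D m b)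
    (hfin : Module.finrank ℚ K = 2) (hD : 4 < D) :
    (chiD D).LFunction 1 = ((Real.pi * classNumber K / Real.sqrt D : ℝ) : ℂ) := by
  rw [← h.dedekindZeta_residue_eq hD]
  have h1 := tendsto_sub_one_mul_dedekindZeta_nhdsGT K
  have hmap : Tendsto (fun s : ℝ ↦ (s : ℂ)) (𝓝[>] 1) (𝓝[≠] 1) := by
    refine tendsto_nhdsWithin_iff.mpr ⟨?_, ?_⟩
    · exact (Complex.continuous_ofReal.tendsto' 1 1 (by simp)).mono_left nhdsWithin_le_nhds
    · filter_upwards [self_mem_nhdsWithin] with s hs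
      simpa using ne_of_gt hs
  have h2 := riemannZeta_residue_one.comp hmap
  have h3 : Tendsto (fun s : ℝ ↦ (chiD D).LFunction s) (𝓝[>] 1) (𝓝 ((chiD D).LFunction 1)) :=
    ((DirichletCharacter.differentiable_LFunction
      (chiD_ne_one (D := D) (by omega))).continuous.tendsto 1).comp
      (hmap.mono_right nhdsWithin_le_nhds)
  have h4 := h2.mul h3
  rw [one_mul] at h4
  refine tendsto_nhds_unique h4 (h1.congr' ?_)
  filter_upwards [self_mem_nhdsWithin] with s hs
  rw [h.dedekindZeta_eq hfin (by simpa using hs)]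
  simp [mul_assoc]

end DedekindZeta

section IdealSums

variable {K : Type} [Field K] [NumberField K] {D m : ℕ}

variable {b : Module.Basis (Fin 2) ℤ (𝓞 K)}

lemma IsHalfIntegralBasis.sum_absNorm_inv_le [Fact D.Prime] (h : IsHalfIntegralBasis D m b)
    (hfin : Module.finrank ℚ K = 2) (s : Finset (Ideal (𝓞 K))) :
    ∑ I ∈ s, ((Ideal.absNorm I : ℝ) ^ 4)⁻¹ ≤ ∑' n : ℕ, ((n : ℝ) ^ 3)⁻¹ := by
  rw [Finset.sum_comp (fun n : ℕ ↦ ((n : ℝ) ^ 4)⁻¹) Ideal.absNorm]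
  refine le_trans (Finset.sum_le_sum fun n _ ↦ ?_)
    (Summable.sum_le_tsum _ (fun n _ ↦ by positivity)
      (Real.summable_nat_pow_inv.mpr (by norm_num : 1 < 3)))
  rcases eq_or_ne n 0 with rfl | hn
  · simp
  have hcard : (s.filter fun I ↦ Ideal.absNorm I = n).card ≤ n := by
    refine le_trans ?_ (h.idealCount_le hfin hn)
    rw [idealCount, ← Set.coe_ofPred, Nat.card_coe_set_eq, ← Set.ncard_coe_finset]
    exact Set.ncard_le_ncard (fun I hI ↦ by simpa using (Finset.mem_filter.mp hI).2)
      (Ideal.finite_setOfPred_absNorm_eq n)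
  have hn0 : (n : ℝ) ≠ 0 := by exact_mod_cast hn
  calc _ = ((s.filter fun I ↦ Ideal.absNorm I = n).card : ℝ) * ((n : ℝ) ^ 4)⁻¹ := by
        rw [nsmul_eq_mul]
    _ ≤ n * ((n : ℝ) ^ 4)⁻¹ := by gcongr
    _ = ((n : ℝ) ^ 3)⁻¹ := by field_simp

lemma IsHalfIntegralBasis.summable_absNorm_inv [Fact D.Prime] (h : IsHalfIntegralBasis D m b)
    (hfin : Module.finrank ℚ K = 2) :
    Summable fun I : Ideal (𝓞 K) ↦ ((Ideal.absNorm I : ℝ) ^ 4)⁻¹ :=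
  summable_of_sum_le (fun _ ↦ by positivity) (h.sum_absNorm_inv_le hfin)

lemma IsHalfIntegralBasis.tsum_absNorm_inv_le [Fact D.Prime] (h : IsHalfIntegralBasis D m b)
    (hfin : Module.finrank ℚ K = 2) :
    ∑' I : Ideal (𝓞 K), ((Ideal.absNorm I : ℝ) ^ 4)⁻¹ ≤ ∑' n : ℕ, ((n : ℝ) ^ 3)⁻¹ :=
  Real.tsum_le_of_sum_le (fun _ ↦ by positivity) (h.sum_absNorm_inv_le hfin)

lemma tsum_ideal_eq_sum_class {E : Type} [NormedAddCommGroup E] [CompleteSpace E]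
    {f : Ideal (𝓞 K) → E} (hf : Summable f) (hf0 : f 0 = 0) :
    ∑' I, f I = ∑ C : ClassGroup (𝓞 K), ∑' I : IdealsInClass K C, f I.1 := by
  have hC : ∀ C : ClassGroup (𝓞 K), ∑' I : IdealsInClass K C, f I.1 =
      ∑' I, {I : Ideal (𝓞 K) | I ≠ 0 ∧ idealClass K I = C}.indicator f I :=
    fun C ↦ tsum_subtype {I : Ideal (𝓞 K) | I ≠ 0 ∧ idealClass K I = C} f
  simp_rw [hC]
  rw [← Summable.tsum_finsetSum fun C _ ↦ hf.indicator _]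
  refine tsum_congr fun I ↦ ?_
  rcases eq_or_ne I 0 with rfl | hI
  · simp [show f ⊥ = 0 from hf0]
  · simp [Set.indicator_apply, show I ≠ ⊥ from hI]

lemma tsum_lambdaChi_mul (χ : ClassGroup (𝓞 K) →* ℂ) {g : ℕ → ℂ} {N : ℕ} (hg0 : g 0 = 0)
    (hg : ∀ n, N < n → g n = 0) :
    ∑' n, lambdaChi K χ n * g n =
      ∑' I : Ideal (𝓞 K), χ (idealClass K I) * g (Ideal.absNorm I) := by
  have hfin : {I : Ideal (𝓞 K) | Ideal.absNorm I ≤ N}.Finite := Ideal.finite_setOfPred_absNorm_le N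
  rw [tsum_eq_sum (s := Finset.range (N + 1)) fun n hn ↦ by
      rw [hg n (by simpa using hn), mul_zero],
    tsum_eq_sum (s := hfin.toFinset) fun I hI ↦ by
      rw [hg _ (by simpa using hI), mul_zero],
    ← Finset.sum_fiberwise_of_maps_to (t := Finset.range (N + 1)) (g := Ideal.absNorm)
      (fun I hI ↦ by simpa [Nat.lt_succ_iff] using hI)]
  refine Finset.sum_congr rfl fun n hn ↦ ?_
  rcases eq_or_ne n 0 with rfl | hn0
  · rw [hg0, mul_zero, Finset.sum_eq_zero]
    intro I hI
    rw [(Finset.mem_filter.mp hI).2, hg0, mul_zero]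
  · have hset : {I : Ideal (𝓞 K) | Ideal.absNorm I = n ∧ I ≠ 0} =
        ((hfin.toFinset.filter fun I ↦ Ideal.absNorm I = n : Finset (Ideal (𝓞 K))) : Set _) := by
      ext I
      simp only [Set.mem_ofPred_eq, Finset.coe_filter, Set.Finite.mem_toFinset]
      refine ⟨fun hI ↦ ⟨?_, hI.1⟩, fun hI ↦ ⟨hI.2, ?_⟩⟩
      · rw [hI.1]
        exact Nat.lt_succ_iff.mp (Finset.mem_range.mp hn)
      · rintro rfl
        exact hn0 (by simpa using hI.2.symm)
    rw [lambdaChi, hset, finsum_mem_coe_finset, Finset.sum_mul]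
    refine Finset.sum_congr rfl fun I hI ↦ ?_
    rw [(Finset.mem_filter.mp hI).2]

end IdealSums

section ClassSums

variable {K : Type} [Field K] [NumberField K] {D m : ℕ}

variable {b : Module.Basis (Fin 2) ℤ (𝓞 K)}

lemma norm_classChar_eq_one (χ : ClassGroup (𝓞 K) →* ℂ) (C : ClassGroup (𝓞 K)) : ‖χ C‖ = 1 :=
  (χ.isOfFinOrder (isOfFinOrder_of_finite C)).norm_eq_one

lemma summable_logBump_absNorm {φ : ℝ → ℝ} {α₁ α₂ X κ : ℝ}
    (hφs : Function.support φ ⊆ Set.Icc α₁ α₂) (hX : 0 < X) :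
    Summable fun I : Ideal (𝓞 K) ↦ logBump 1 φ X κ (Ideal.absNorm I) := by
  refine summable_of_hasFiniteSupport
    ((Ideal.finite_setOfPred_absNorm_le ⌊Real.exp (X * α₂ - κ)⌋₊).subset fun I hI ↦ ?_)
  by_contra hlt
  exact hI (logBump_eq_zero_of_gt hφs hX (Nat.lt_of_floor_lt (not_le.mp hlt)))

/-- Smooth sums over the ideals of one ideal class, on a logarithmic scale. -/
lemma exists_abs_tsum_idealsInClass_sub_le {α₁ α₂ : ℝ} (M : ℕ) {φ : ℝ → ℝ}
    (hφ : ContDiff ℝ (⊤ : ℕ∞) φ) (hφs : Function.support φ ⊆ Set.Icc α₁ α₂) :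
    ∃ B : ℝ, 0 ≤ B ∧ ∀ (D m : ℕ) [Fact D.Prime] (K : Type) [Field K] [NumberField K]
      (b : Module.Basis (Fin 2) ℤ (𝓞 K)), IsHalfIntegralBasis D m b → 4 < D →
      Module.finrank ℚ K = 2 →
      ∀ (X κ : ℝ) (C : ClassGroup (𝓞 K)), 1 / 2 ≤ X → D ≤ Real.exp (X * α₁ - κ) →
      |∑' I : IdealsInClass K C, logBump 1 φ X κ (Ideal.absNorm I.1) -
        Real.pi / Real.sqrt D * X * ∫ u, φ u| ≤
      B * (X ^ M)⁻¹ * (Real.sqrt D)⁻¹ *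
        ∑' I : IdealsInClass K C, ((Ideal.absNorm I.1 : ℝ) ^ 4)⁻¹ := by
  obtain ⟨B, hB0, hB⟩ := exists_norm_tsum_logBump_sub_le M hφ hφs
  refine ⟨B, hB0, fun D m _ K _ _ b h hD hfin X κ C hX hDX ↦ ?_⟩
  obtain ⟨z₁, z₂, hz, hF⟩ := h.exists_lattice_tsum hD C
  have h1 := hF (logBump 1 φ X κ) (logBump_of_nonpos le_rfl)
    ((summable_logBump_absNorm (K := K) hφs (by linarith)).comp_injective Subtype.val_injective)
  have h2 := hF (fun t ↦ (t ^ 4)⁻¹) (by simp)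
    ((h.summable_absNorm_inv hfin).comp_injective Subtype.val_injective)
  have h3 := hB X κ D z₁ z₂ hX (by exact_mod_cast (by omega : 0 < D)) hDX hz h2.summable
  rw [h1.tsum_eq, h2.tsum_eq] at h3
  set S := ∑' I : IdealsInClass K C, logBump 1 φ X κ (Ideal.absNorm I.1)
  set T := ∑' I : IdealsInClass K C, ((Ideal.absNorm I.1 : ℝ) ^ 4)⁻¹
  have h4 : 2 * S - 2 / Real.sqrt D * (Real.pi * X * ∫ u, φ u) =
      2 * (S - Real.pi / Real.sqrt D * X * ∫ u, φ u) := by ring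
  rw [h4, abs_mul, abs_two] at h3
  linarith

/-- Smooth sums of the values of a class group character, on a logarithmic scale. -/
lemma exists_norm_tsum_classChar_sub_le {α₁ α₂ : ℝ} (M : ℕ) {φ : ℝ → ℝ}
    (hφ : ContDiff ℝ (⊤ : ℕ∞) φ) (hφs : Function.support φ ⊆ Set.Icc α₁ α₂) :
    ∃ B : ℝ, 0 ≤ B ∧ ∀ (D m : ℕ) [Fact D.Prime] (K : Type) [Field K] [NumberField K]
      (b : Module.Basis (Fin 2) ℤ (𝓞 K)), IsHalfIntegralBasis D m b → 4 < D →
      Module.finrank ℚ K = 2 →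
      ∀ (X κ : ℝ) (χ : ClassGroup (𝓞 K) →* ℂ), 1 / 2 ≤ X → D ≤ Real.exp (X * α₁ - κ) →
      ‖∑' I : Ideal (𝓞 K), χ (idealClass K I) * (logBump 1 φ X κ (Ideal.absNorm I) : ℂ) -
        (chiD D).LFunction 1 * ((∫ u, φ u : ℝ) : ℂ) * (X : ℂ) * (if χ = 1 then 1 else 0)‖ ≤
      B * (X ^ M)⁻¹ * (Real.sqrt D)⁻¹ := by
  obtain ⟨B, hB0, hB⟩ := exists_abs_tsum_idealsInClass_sub_le M hφ hφs
  refine ⟨B * ∑' n : ℕ, ((n : ℝ) ^ 3)⁻¹, by positivity,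
    fun D m _ K _ _ b h hD hfin X κ χ hX hDX ↦ ?_⟩
  have hX0 : 0 < X := by linarith
  have hbump := summable_logBump_absNorm (K := K) (κ := κ) hφs hX0
  have hsum : Summable fun I : Ideal (𝓞 K) ↦
      χ (idealClass K I) * (logBump 1 φ X κ (Ideal.absNorm I) : ℂ) :=
    .of_norm <| hbump.norm.congr fun I ↦ by
      rw [norm_mul, norm_classChar_eq_one, one_mul, Complex.norm_real]
  have hclass : ∀ C : ClassGroup (𝓞 K), ∑' I : IdealsInClass K C,
      χ (idealClass K I.1) * (logBump 1 φ X κ (Ideal.absNorm I.1) : ℂ) =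
      χ C * ((∑' I : IdealsInClass K C, logBump 1 φ X κ (Ideal.absNorm I.1) : ℝ) : ℂ) := by
    intro C
    rw [Complex.ofReal_tsum, ← tsum_mul_left]
    exact tsum_congr fun I ↦ by rw [I.2.2]
  have hmain : (chiD D).LFunction 1 * ((∫ u, φ u : ℝ) : ℂ) * (X : ℂ) *
      (if χ = 1 then 1 else 0) = ∑ C : ClassGroup (𝓞 K),
        χ C * ((Real.pi / Real.sqrt D * X * ∫ u, φ u : ℝ) : ℂ) := by
    rw [← Finset.sum_mul, sum_hom_units, h.LFunction_one_eq hfin hD]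
    split_ifs
    · rw [classNumber]
      push_cast
      ring
    · simp
  rw [tsum_ideal_eq_sum_class hsum (by simp [logBump_of_nonpos])]
  simp_rw [hclass]
  rw [hmain, ← Finset.sum_sub_distrib]
  refine (norm_sum_le _ _).trans ?_
  calc _ ≤ ∑ C : ClassGroup (𝓞 K), B * (X ^ M)⁻¹ * (Real.sqrt D)⁻¹ *
        ∑' I : IdealsInClass K C, ((Ideal.absNorm I.1 : ℝ) ^ 4)⁻¹ := by
        refine Finset.sum_le_sum fun C _ ↦ ?_
        rw [← mul_sub, norm_mul, norm_classChar_eq_one, one_mul, ← Complex.ofReal_sub,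
          Complex.norm_real]
        exact hB D m K b h hD hfin X κ C hX hDX
    _ = B * (X ^ M)⁻¹ * (Real.sqrt D)⁻¹ * ∑' I : Ideal (𝓞 K), ((Ideal.absNorm I : ℝ) ^ 4)⁻¹ := by
        rw [← Finset.mul_sum, tsum_ideal_eq_sum_class (h.summable_absNorm_inv hfin) (by simp)]
    _ ≤ B * (X ^ M)⁻¹ * (Real.sqrt D)⁻¹ * ∑' n : ℕ, ((n : ℝ) ^ 3)⁻¹ := by
        gcongr
        exact h.tsum_absNorm_inv_le hfin
    _ = _ := by ring

end ClassSums

open Classical in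
theorem lambda_chi_summation_in_log_scale
    (α₁ α₂ : ℝ) (h1 : 0 < α₁) (h12 : α₁ < α₂) (φ : ℝ → ℝ)
    (hφ : ContDiff ℝ (⊤ : ℕ∞) φ) (hφs : Function.support φ ⊆ Set.Icc α₁ α₂)
    (A : ℝ) (hA : 0 < A) :
    ∃ C : ℝ, ∀ (D : ℕ) [Fact (Nat.Prime D)], 3 < D → D % 4 = 3 →
    ∀ (K : Type) [Field K] [NumberField K], Module.finrank ℚ K = 2 →
      (∃ α : K, α ^ 2 = -(D : K)) →
    ∀ (χ : ClassGroup (𝓞 K) →* ℂ) (x : ℝ) (k : ℕ), 2 ≤ x → 1 ≤ k →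
      (k : ℝ) ≤ x ^ α₁ / D →
    ‖(∑' ℓ : ℕ, lambdaChi K χ ℓ / ℓ *
          ((φ (Real.log ((k : ℝ) * ℓ) / Real.log x) : ℝ) : ℂ)) -
        (chiD D).LFunction 1 * ((∫ u, φ u : ℝ) : ℂ) * ((Real.log x : ℝ) : ℂ) *
          (if χ = 1 then 1 else 0)‖ ≤
      C * (D : ℝ) ^ (-(1 / 2 : ℝ)) * Real.log x ^ (-A) := by
  obtain ⟨B, hB0, hB⟩ := exists_norm_tsum_classChar_sub_le ⌈A⌉₊ hφ hφs
  refine ⟨B * (Real.log 2 ^ (⌈A⌉₊ - A))⁻¹, ?_⟩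
  intro D _ hD hD4 K _ _ hfin ⟨α, hα⟩ χ x k hx hk hkx
  obtain ⟨b, hb0, hb1⟩ := exists_integral_basis hD4 hfin hα
  have hb : IsHalfIntegralBasis D ((D + 1) / 4) b := ⟨hb0, hb1, by omega⟩
  have hlog2 : (1 / 2 : ℝ) < Real.log 2 := by linarith [Real.log_two_gt_d9]
  have hlogx : Real.log 2 ≤ Real.log x := Real.log_le_log (by norm_num) hx
  have hX : 0 < Real.log x := by linarith
  have hk0 : (0 : ℝ) < k := by exact_mod_cast hk
  have hDpos : (0 : ℝ) < D := by exact_mod_cast (by omega : 0 < D)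
  have hDX : (D : ℝ) ≤ Real.exp (Real.log x * α₁ - Real.log k) := by
    rw [Real.exp_sub, Real.exp_log hk0, ← Real.rpow_def_of_pos (by linarith), le_div_iff₀ hk0,
      mul_comm]
    exact (le_div_iff₀ hDpos).mp hkx
  have hbump : ∀ ℓ : ℕ, lambdaChi K χ ℓ / ℓ *
      ((φ (Real.log ((k : ℝ) * ℓ) / Real.log x) : ℝ) : ℂ) =
      lambdaChi K χ ℓ * (logBump 1 φ (Real.log x) (Real.log k) ℓ : ℂ) := by
    intro ℓ
    rcases Nat.eq_zero_or_pos ℓ with rfl | hℓ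
    · simp [logBump_of_nonpos]
    · have hℓ0 : (0 : ℝ) < ℓ := by exact_mod_cast hℓ
      rw [logBump_of_pos hℓ0, Real.log_mul hk0.ne' hℓ0.ne', add_comm]
      push_cast
      ring
  simp_rw [hbump]
  rw [tsum_lambdaChi_mul χ (g := fun n : ℕ ↦ (logBump 1 φ (Real.log x) (Real.log k) n : ℂ))
    (N := ⌊Real.exp (Real.log x * α₂ - Real.log k)⌋₊) (by simp [logBump_of_nonpos])
    fun n hn ↦ by rw [logBump_eq_zero_of_gt hφs hX (Nat.lt_of_floor_lt hn), Complex.ofReal_zero]]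
  refine (hB D _ K b hb (by omega) hfin _ _ χ (by linarith) hDX).trans ?_
  have hpow : (Real.log x ^ ⌈A⌉₊)⁻¹ ≤ (Real.log 2 ^ (⌈A⌉₊ - A))⁻¹ * Real.log x ^ (-A) := by
    rw [Real.rpow_neg hX.le, ← mul_inv]
    have h2 : 0 < Real.log 2 := by linarith
    gcongr
    calc Real.log 2 ^ (⌈A⌉₊ - A) * Real.log x ^ A
        ≤ Real.log x ^ (⌈A⌉₊ - A) * Real.log x ^ A := by
          gcongr
          exact sub_nonneg.mpr (Nat.le_ceil A)
      _ = Real.log x ^ ⌈A⌉₊ := by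
          rw [← Real.rpow_add hX, sub_add_cancel, Real.rpow_natCast]
  rw [Real.rpow_neg hDpos.le, ← Real.sqrt_eq_rpow]
  calc _ ≤ B * ((Real.log 2 ^ (⌈A⌉₊ - A))⁻¹ * Real.log x ^ (-A)) * (Real.sqrt D)⁻¹ := by gcongr
    _ = _ := by ring
end

section
/- There is an absolute constant K such that the following holds. Let c > 0, let D > 3 be a prime with D ≡ 3 (mod 4), suppose Hypothesis H(c) holds for L(s, χ_D), let x ≥ 2, define θ by D = x^{θ}, and let 0 < α₁ < α₂ < 1. Then Σ_{x^{α₁} ≤ p ≤ x^{α₂}} λ_{χ₀}(p)/p ≤ K (log(α₂/α₁) + e^{−c α₁/(3θ)}), where the sum is over rational primes p and λ_{χ₀}(p) = 1 + χ_D(p). -/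
open NumberField
open scoped Classical

/-- The Kronecker symbol χ_D(n) = (−D/n) as an integer-valued function. -/
noncomputable def chiDZ (D : ℕ) [Fact (Nat.Prime D)] (n : ℕ) : ℤ :=
  quadraticChar (ZMod D) (n : ZMod D)

/-- Hypothesis H(c): every zero ρ of L(s, χ_D) with |Im ρ| ≤ 1 has Re ρ ≤ 1 - c/log D. -/
def HypH (c : ℝ) (D : ℕ) [Fact (Nat.Prime D)] : Prop :=
  ∀ ρ : ℂ, (chiD D).LFunction ρ = 0 → |ρ.im| ≤ 1 → ρ.re ≤ 1 - c / Real.log D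

open Finset ArithmeticFunction in
theorem sum_Icc_moebius_div_of_dvd (R l m : ℕ) (hl : 0 < l) (hm : m ∈ Icc 1 R) :
    (∑ d ∈ Icc 1 R, if l ∣ d ∧ d ∣ m then ((moebius (m / d) : ℤ) : ℝ) else 0) =
      if l = m then 1 else 0 := by
  obtain ⟨hm1, hmR⟩ := mem_Icc.mp hm
  by_cases hlm : l ∣ m
  · obtain ⟨k, rfl⟩ := hlm
    have hk : 0 < k := Nat.pos_of_ne_zero fun h => by simp [h] at hm1
    rw [← sum_filter]
    have himage : {d ∈ Icc 1 R | l ∣ d ∧ d ∣ l * k} = k.divisors.image (l * ·) := by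
      ext d
      simp only [mem_filter, mem_Icc, mem_image, Nat.mem_divisors]
      constructor
      · rintro ⟨-, ⟨e, rfl⟩, h⟩
        exact ⟨e, ⟨Nat.dvd_of_mul_dvd_mul_left hl h, hk.ne'⟩, rfl⟩
      · rintro ⟨e, ⟨he, -⟩, rfl⟩
        have hdvd : l * e ∣ l * k := mul_dvd_mul_left l he
        have hpos : 0 < l * e := Nat.mul_pos hl (Nat.pos_of_dvd_of_pos he hk)
        exact ⟨⟨hpos, (Nat.le_of_dvd hm1 hdvd).trans hmR⟩, dvd_mul_right _ _, hdvd⟩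
    rw [himage, sum_image fun a _ b _ h => Nat.eq_of_mul_eq_mul_left hl h]
    simp_rw [Nat.mul_div_mul_left _ _ hl]
    rw [Nat.sum_div_divisors k fun d => ((moebius d : ℤ) : ℝ), ← Int.cast_sum,
      ← coe_mul_zeta_apply, moebius_mul_coe_zeta, one_apply]
    have hiff : l = l * k ↔ k = 1 := by
      constructor
      · intro h
        exact Nat.eq_of_mul_eq_mul_left hl (by rw [← h, mul_one])
      · rintro rfl; simp
    simp [hiff]
  · rw [if_neg fun h => hlm h.dvd]
    exact sum_eq_zero fun d _ => if_neg fun h => hlm (h.1.trans h.2)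


/-- The total mass `∑_{l ≤ R} μ(l)² / φ(l)` of Selberg's sieve of level `R`. -/
noncomputable def selbergMass (R : ℕ) : ℝ :=
  ∑ l ∈ Finset.Icc 1 R, ((ArithmeticFunction.moebius l : ℤ) : ℝ) ^ 2 / (l.totient : ℝ)

/-- Selberg's sieve weights of level `R`, normalised so that the weight at `1` is
`selbergMass R`. -/
noncomputable def selbergWeight (R d : ℕ) : ℝ :=
  d * ∑ m ∈ Finset.Icc 1 R, if d ∣ m then ((ArithmeticFunction.moebius (m / d) : ℤ) : ℝ) *
    (((ArithmeticFunction.moebius m : ℤ) : ℝ) / (m.totient : ℝ)) else 0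

theorem selbergWeight_one (R : ℕ) : selbergWeight R 1 = selbergMass R := by
  simp only [selbergWeight, selbergMass, one_dvd, if_true, Nat.div_one, Nat.cast_one, one_mul]
  exact Finset.sum_congr rfl fun m _ => by ring

theorem one_le_selbergMass {R : ℕ} (hR : 1 ≤ R) : 1 ≤ selbergMass R := by
  have h := Finset.single_le_sum
    (f := fun l : ℕ => ((ArithmeticFunction.moebius l : ℤ) : ℝ) ^ 2 / (l.totient : ℝ))
    (fun l _ => by positivity) (Finset.mem_Icc.mpr ⟨le_rfl, hR⟩)
  simpa [selbergMass] using h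

theorem abs_moebius_real_le_one (n : ℕ) : |((ArithmeticFunction.moebius n : ℤ) : ℝ)| ≤ 1 := by
  exact_mod_cast (ArithmeticFunction.abs_moebius_le_one (n := n))

theorem abs_selbergWeight_le {R d : ℕ} (hd : d ≤ R) : |selbergWeight R d| ≤ (R : ℝ) ^ 2 := by
  rw [selbergWeight, abs_mul, Nat.abs_cast, sq]
  gcongr
  calc _ ≤ ∑ m ∈ Finset.Icc 1 R, (1 : ℝ) := by
        refine (Finset.abs_sum_le_sum_abs _ _).trans (Finset.sum_le_sum fun m hm => ?_)
        split_ifs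
        · rw [abs_mul, abs_div, Nat.abs_cast]
          have hφ : (1 : ℝ) ≤ (m.totient : ℝ) := by
            exact_mod_cast Nat.totient_pos.mpr (Finset.mem_Icc.mp hm).1
          exact mul_le_one₀ (abs_moebius_real_le_one _) (by positivity)
            (div_le_one_of_le₀ ((abs_moebius_real_le_one _).trans hφ) (by positivity))
        · simp
    _ = R := by simp

theorem sum_selbergWeight_div {R l : ℕ} (hl : l ∈ Finset.Icc 1 R) :
    (∑ d ∈ Finset.Icc 1 R, if l ∣ d then selbergWeight R d / d else 0) =
      ((ArithmeticFunction.moebius l : ℤ) : ℝ) / (l.totient : ℝ) := by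
  calc _ = ∑ m ∈ Finset.Icc 1 R, (∑ d ∈ Finset.Icc 1 R,
        if l ∣ d ∧ d ∣ m then ((ArithmeticFunction.moebius (m / d) : ℤ) : ℝ) else 0) *
          (((ArithmeticFunction.moebius m : ℤ) : ℝ) / (m.totient : ℝ)) := by
        simp_rw [Finset.sum_mul]
        rw [Finset.sum_comm]
        refine Finset.sum_congr rfl fun d hd => ?_
        have hd0 : (d : ℝ) ≠ 0 := by
          have := (Finset.mem_Icc.mp hd).1
          positivity
        by_cases h : l ∣ d
        · simp [h, selbergWeight, hd0, ite_mul]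
        · simp [h]
    _ = ∑ m ∈ Finset.Icc 1 R, if l = m then
          (((ArithmeticFunction.moebius m : ℤ) : ℝ) / (m.totient : ℝ)) else 0 := by
        refine Finset.sum_congr rfl fun m hm => ?_
        rw [sum_Icc_moebius_div_of_dvd R l m (Finset.mem_Icc.mp hl).1 hm]
        simp
    _ = _ := by rw [Finset.sum_ite_eq]; simp only [hl, if_true]

theorem gcd_eq_sum_totient {R d e : ℕ} (hd : d ∈ Finset.Icc 1 R) :
    ((d.gcd e : ℕ) : ℝ) =
      ∑ l ∈ Finset.Icc 1 R, if l ∣ d ∧ l ∣ e then (l.totient : ℝ) else 0 := by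
  obtain ⟨hd1, hdR⟩ := Finset.mem_Icc.mp hd
  rw [← Finset.sum_filter, ← Nat.sum_totient (d.gcd e), Nat.cast_sum]
  refine Finset.sum_congr ?_ fun _ _ => rfl
  ext l
  simp only [Nat.mem_divisors, Nat.dvd_gcd_iff, Finset.mem_filter, Finset.mem_Icc]
  constructor
  · rintro ⟨h, -⟩
    exact ⟨⟨Nat.pos_of_dvd_of_pos h.1 hd1, (Nat.le_of_dvd hd1 h.1).trans hdR⟩, h⟩
  · rintro ⟨-, h⟩
    exact ⟨h, (Nat.gcd_pos_of_pos_left _ hd1).ne'⟩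

/-- Diagonalisation of Selberg's quadratic form at the optimal weights. -/
theorem sum_selbergWeight_mul_div_lcm (R : ℕ) :
    ∑ d ∈ Finset.Icc 1 R, ∑ e ∈ Finset.Icc 1 R,
      selbergWeight R d * selbergWeight R e / (d.lcm e : ℕ) = selbergMass R := by
  calc _ = ∑ d ∈ Finset.Icc 1 R, ∑ e ∈ Finset.Icc 1 R, ∑ l ∈ Finset.Icc 1 R,
        (l.totient : ℝ) * ((if l ∣ d then selbergWeight R d / d else 0) *
          (if l ∣ e then selbergWeight R e / e else 0)) := by
        refine Finset.sum_congr rfl fun d hd => Finset.sum_congr rfl fun e he => ?_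
        have hd0 : (d : ℝ) ≠ 0 := by
          have := (Finset.mem_Icc.mp hd).1
          positivity
        have he0 : (e : ℝ) ≠ 0 := by
          have := (Finset.mem_Icc.mp he).1
          positivity
        have hg0 : ((d.gcd e : ℕ) : ℝ) ≠ 0 := by
          exact_mod_cast (Nat.gcd_pos_of_pos_left _ (Finset.mem_Icc.mp hd).1).ne'
        have hlcm : ((d.lcm e : ℕ) : ℝ) = d * e / (d.gcd e : ℕ) := by
          rw [eq_div_iff hg0, mul_comm]
          exact_mod_cast Nat.gcd_mul_lcm d e
        have hsplit : selbergWeight R d * selbergWeight R e / (d.lcm e : ℕ) =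
            (d.gcd e : ℕ) * (selbergWeight R d / d * (selbergWeight R e / e)) := by
          rw [hlcm]
          field_simp
        rw [hsplit, gcd_eq_sum_totient hd, Finset.sum_mul]
        refine Finset.sum_congr rfl fun l _ => ?_
        by_cases h1 : l ∣ d <;> by_cases h2 : l ∣ e <;> simp [h1, h2]
    _ = ∑ l ∈ Finset.Icc 1 R, (l.totient : ℝ) *
        ((∑ d ∈ Finset.Icc 1 R, if l ∣ d then selbergWeight R d / d else 0) *
          ∑ e ∈ Finset.Icc 1 R, if l ∣ e then selbergWeight R e / e else 0) := by
        simp_rw [Finset.sum_mul_sum, Finset.mul_sum]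
        symm
        rw [Finset.sum_comm]
        exact Finset.sum_congr rfl fun d _ => Finset.sum_comm
    _ = selbergMass R := by
        refine Finset.sum_congr rfl fun l hl => ?_
        rw [sum_selbergWeight_div hl]
        have hφ : (l.totient : ℝ) ≠ 0 := by
          exact_mod_cast (Nat.totient_pos.mpr (Finset.mem_Icc.mp hl).1).ne'
        field_simp

theorem card_Ioc_filter_dvd_le (M N : ℕ) {r : ℕ} (hr : 0 < r) :
    |(((Finset.Ioc M (M + N)).filter (r ∣ ·)).card : ℝ) - N / r| ≤ 1 := by
  have h := Nat.Ioc_filter_modEq_card M (M + N) hr 0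
  simp_rw [Nat.modEq_zero_iff_dvd] at h
  have h2 : ((((Finset.Ioc M (M + N)).filter (r ∣ ·)).card : ℤ)) =
    ⌊((M + N : ℕ) : ℚ) / r⌋ - ⌊(M : ℚ) / r⌋ := by
    rw [h, max_eq_left]
    · simp
    · rw [sub_nonneg]
      apply Int.floor_le_floor
      push_cast
      gcongr
      linarith [(Nat.cast_nonneg N : (0 : ℚ) ≤ N)]
  have h3 : |(((Finset.Ioc M (M + N)).filter (r ∣ ·)).card : ℚ) - N / r| ≤ 1 := by
    have h4 : ((((Finset.Ioc M (M + N)).filter (r ∣ ·)).card : ℚ)) =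
      (⌊((M + N : ℕ) : ℚ) / r⌋ : ℚ) - (⌊(M : ℚ) / r⌋ : ℚ) := by exact_mod_cast h2
    rw [h4]
    have a1 := Int.floor_le (((M + N : ℕ) : ℚ) / r)
    have a2 := Int.lt_floor_add_one (((M + N : ℕ) : ℚ) / r)
    have b1 := Int.floor_le ((M : ℚ) / r)
    have b2 := Int.lt_floor_add_one ((M : ℚ) / r)
    have hs : ((M + N : ℕ) : ℚ) / r = (M : ℚ) / r + N / r := by push_cast; ring
    rw [abs_le]
    constructor <;> linarith
  have h4 := (Rat.cast_le (K := ℝ)).mpr h3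
  push_cast at h4
  exact h4

/-- Selberg's upper bound for the number of primes in an interval. -/
theorem card_primes_Ioc_le (M N : ℕ) {R : ℕ} (hR : 1 ≤ R) :
    (((Finset.Ioc M (M + N)).filter Nat.Prime).card : ℝ) ≤
      N / selbergMass R + R ^ 6 + R := by
  set G := selbergMass R with hG
  have hG1 : 1 ≤ G := one_le_selbergMass hR
  set I := Finset.Ioc M (M + N) with hI
  set w := selbergWeight R with hw
  have hsq : ∑ n ∈ I, (∑ d ∈ Finset.Icc 1 R, if d ∣ n then w d else 0) ^ 2 ≤
      N * G + R ^ 6 := by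
    calc _ = ∑ d ∈ Finset.Icc 1 R, ∑ e ∈ Finset.Icc 1 R,
          w d * w e * ((I.filter (d.lcm e ∣ ·)).card : ℝ) := by
          simp_rw [sq, Finset.sum_mul_sum]
          rw [Finset.sum_comm]
          refine Finset.sum_congr rfl fun d _ => ?_
          rw [Finset.sum_comm]
          refine Finset.sum_congr rfl fun e _ => ?_
          rw [Finset.card_filter, Nat.cast_sum, Finset.mul_sum]
          refine Finset.sum_congr rfl fun n _ => ?_
          by_cases h1 : d ∣ n <;> by_cases h2 : e ∣ n <;> simp [Nat.lcm_dvd_iff, h1, h2]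
      _ ≤ ∑ d ∈ Finset.Icc 1 R, ∑ e ∈ Finset.Icc 1 R,
          (N * (w d * w e / (d.lcm e : ℕ)) + (R : ℝ) ^ 4) := by
          refine Finset.sum_le_sum fun d hd => Finset.sum_le_sum fun e he => ?_
          obtain ⟨hd1, hdR⟩ := Finset.mem_Icc.mp hd
          obtain ⟨he1, heR⟩ := Finset.mem_Icc.mp he
          have hcard := card_Ioc_filter_dvd_le M N (Nat.lcm_pos hd1 he1)
          have hww : |w d * w e| ≤ (R : ℝ) ^ 4 := by
            rw [abs_mul]
            calc _ ≤ (R : ℝ) ^ 2 * (R : ℝ) ^ 2 :=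
                  mul_le_mul (abs_selbergWeight_le hdR) (abs_selbergWeight_le heR)
                    (abs_nonneg _) (by positivity)
              _ = _ := by ring
          have hprod : w d * w e * (((I.filter (d.lcm e ∣ ·)).card : ℝ) - N / (d.lcm e : ℕ)) ≤
              (R : ℝ) ^ 4 := by
            refine (le_abs_self _).trans ?_
            rw [abs_mul]
            exact (mul_le_of_le_one_right (abs_nonneg _) hcard).trans hww
          have hring : w d * w e * (((I.filter (d.lcm e ∣ ·)).card : ℝ) - N / (d.lcm e : ℕ)) =
              w d * w e * ((I.filter (d.lcm e ∣ ·)).card : ℝ) -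
                N * (w d * w e / (d.lcm e : ℕ)) := by ring
          linarith
      _ = N * G + R ^ 6 := by
          simp_rw [Finset.sum_add_distrib, ← Finset.mul_sum]
          rw [sum_selbergWeight_mul_div_lcm]
          simp
          ring
  have hbig : ((I.filter fun n => n.Prime ∧ R < n).card : ℝ) * G ^ 2 ≤ N * G + R ^ 6 := by
    refine le_trans ?_ hsq
    rw [← nsmul_eq_mul, ← Finset.sum_const]
    refine le_trans (Finset.sum_le_sum fun n hn => ?_)
      (Finset.sum_le_sum_of_subset_of_nonneg (Finset.filter_subset _ _) fun _ _ _ => sq_nonneg _)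
    obtain ⟨-, hp, hRn⟩ := Finset.mem_filter.mp hn
    refine le_of_eq ?_
    congr 1
    rw [Finset.sum_eq_single_of_mem 1 (Finset.mem_Icc.mpr ⟨le_rfl, hR⟩)]
    · simp [hw, hG, selbergWeight_one]
    · intro d hd hd1
      refine if_neg fun hdn => ?_
      rcases (Nat.dvd_prime hp).mp hdn with h | h
      · exact hd1 h
      · have := (Finset.mem_Icc.mp hd).2
        omega
  have hbig' : ((I.filter fun n => n.Prime ∧ R < n).card : ℝ) ≤ N / G + R ^ 6 := by
    have hG0 : 0 < G := by linarith
    have h1 : ((I.filter fun n => n.Prime ∧ R < n).card : ℝ) ≤ (N * G + R ^ 6) / G ^ 2 := by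
      rwa [le_div_iff₀ (by positivity)]
    have h2 : (N * G + (R : ℝ) ^ 6) / G ^ 2 = N / G + R ^ 6 / G ^ 2 := by
      field_simp
    have h3 : (R : ℝ) ^ 6 / G ^ 2 ≤ R ^ 6 := div_le_self (by positivity) (one_le_pow₀ hG1)
    linarith
  have hcover : I.filter Nat.Prime ⊆
      (I.filter fun n => n.Prime ∧ R < n) ∪ Finset.Icc 1 R := by
    intro n hn
    obtain ⟨hnI, hp⟩ := Finset.mem_filter.mp hn
    rcases lt_or_ge R n with h | h
    · exact Finset.mem_union_left _ (Finset.mem_filter.mpr ⟨hnI, hp, h⟩)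
    · exact Finset.mem_union_right _ (Finset.mem_Icc.mpr ⟨hp.one_lt.le, h⟩)
  have hcard : ((I.filter Nat.Prime).card : ℝ) ≤
      ((I.filter fun n => n.Prime ∧ R < n).card : ℝ) + R := by
    have := (Finset.card_le_card hcover).trans (Finset.card_union_le _ _)
    rw [Nat.card_Icc] at this
    exact_mod_cast this
  linarith

theorem log_le_two_mul_selbergMass (R : ℕ) : Real.log (R + 1 : ℕ) ≤ 2 * selbergMass R := by
  have hharm : ((harmonic R : ℚ) : ℝ) = ∑ n ∈ Finset.Icc 1 R, ((n : ℝ))⁻¹ := by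
    rw [harmonic_eq_sum_Icc]
    push_cast
    rfl
  have hle : ∑ n ∈ Finset.Icc 1 R, ((n : ℝ))⁻¹ ≤ ∑ k ∈ Finset.Icc 1 R, ∑ l ∈ Finset.Icc 1 R,
      ((k : ℝ) ^ 2)⁻¹ * (((ArithmeticFunction.moebius l : ℤ) : ℝ) ^ 2 / (l.totient : ℝ)) := by
    rw [← Finset.sum_product']
    calc _ ≤ ∑ n ∈ Finset.Icc 1 R, ∑ q ∈ Finset.Icc 1 R ×ˢ Finset.Icc 1 R,
          if q.1 ^ 2 * q.2 = n then ((q.1 : ℝ) ^ 2)⁻¹ *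
            (((ArithmeticFunction.moebius q.2 : ℤ) : ℝ) ^ 2 / (q.2.totient : ℝ)) else 0 := by
          refine Finset.sum_le_sum fun n hn => ?_
          obtain ⟨hn1, hnR⟩ := Finset.mem_Icc.mp hn
          obtain ⟨l, k, hl, hk, hkl, hsf⟩ := Nat.sq_mul_squarefree_of_pos hn1
          have hkn : k ≤ n := by nlinarith [Nat.le_self_pow two_ne_zero k]
          have hln : l ≤ n := by nlinarith [Nat.pow_pos (n := 2) hk]
          refine le_trans ?_ (Finset.single_le_sum (fun q _ => ?_)
            (Finset.mem_product.mpr (⟨Finset.mem_Icc.mpr ⟨hk, hkn.trans hnR⟩,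
              Finset.mem_Icc.mpr ⟨hl, hln.trans hnR⟩⟩ :
              (k, l).1 ∈ Finset.Icc 1 R ∧ (k, l).2 ∈ Finset.Icc 1 R)))
          · have hμ : ((ArithmeticFunction.moebius l : ℤ) : ℝ) ^ 2 = 1 := by
              exact_mod_cast ArithmeticFunction.moebius_sq_eq_one_of_squarefree hsf
            have hφ : (0 : ℝ) < (l.totient : ℝ) := by exact_mod_cast Nat.totient_pos.mpr hl
            simp only [hkl, if_true, hμ]
            rw [← hkl]
            push_cast
            rw [mul_inv, one_div]
            gcongr
            exact Nat.totient_le l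
          · split_ifs <;> positivity
      _ ≤ _ := by
          rw [Finset.sum_comm]
          refine Finset.sum_le_sum fun q _ => ?_
          rw [Finset.sum_ite_eq]
          split_ifs
          · rfl
          · positivity
  have hsq : ∑ k ∈ Finset.Icc 1 R, ((k : ℝ) ^ 2)⁻¹ ≤ 2 := by
    have h := sum_Ioo_inv_sq_le (α := ℝ) 0 (R + 1)
    have hI : Finset.Ioo 0 (R + 1) = Finset.Icc 1 R := by
      ext; simp only [Finset.mem_Ioo, Finset.mem_Icc]; omega
    rw [hI] at h
    simpa using h
  have hmass : 0 ≤ selbergMass R := Finset.sum_nonneg fun l _ => by positivity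
  calc Real.log (R + 1 : ℕ) ≤ (harmonic R : ℚ) := log_add_one_le_harmonic R
    _ ≤ _ := hharm.trans_le hle
    _ = (∑ k ∈ Finset.Icc 1 R, ((k : ℝ) ^ 2)⁻¹) * selbergMass R := by
        rw [selbergMass, Finset.sum_mul_sum]
    _ ≤ 2 * selbergMass R := by gcongr

/-- A Brun–Titchmarsh bound with a non-optimal constant. -/
theorem card_primes_Ioc_le_div_log (M : ℕ) {N : ℕ} (hN : 2 ≤ N) :
    (((Finset.Ioc M (M + N)).filter Nat.Prime).card : ℝ) ≤ 28 * N / Real.log N := by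
  have hN2 : (2 : ℝ) ≤ N := by exact_mod_cast hN
  have hN0 : (0 : ℝ) < N := by linarith
  have hlog : 0 < Real.log N := Real.log_pos (by linarith)
  set t : ℝ := (N : ℝ) ^ (1 / 12 : ℝ) with ht
  have ht1 : 1 ≤ t := Real.one_le_rpow (by linarith) (by norm_num)
  set R : ℕ := ⌊t⌋₊ with hRdef
  have hR : 1 ≤ R := Nat.one_le_floor_iff t |>.mpr ht1
  have hRt : (R : ℝ) ≤ t := Nat.floor_le (by linarith)
  have htR : t < R + 1 := Nat.lt_floor_add_one t
  have hmass : Real.log N / 24 ≤ selbergMass R := by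
    have h1 := log_le_two_mul_selbergMass R
    have h2 : Real.log t ≤ Real.log (R + 1 : ℕ) :=
      Real.log_le_log (by linarith) (by push_cast; exact htR.le)
    rw [ht, Real.log_rpow hN0] at h2
    linarith
  have hmain : N / selbergMass R ≤ 24 * (N / Real.log N) := by
    calc N / selbergMass R ≤ N / (Real.log N / 24) := by gcongr
      _ = _ := by field_simp
  have hR6 : (R : ℝ) ^ 6 ≤ 2 * (N / Real.log N) := by
    have h1 : (R : ℝ) ^ 6 ≤ (N : ℝ) ^ (1 / 2 : ℝ) := by
      calc (R : ℝ) ^ 6 ≤ t ^ 6 := by gcongr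
        _ = _ := by
          rw [ht, ← Real.rpow_natCast, ← Real.rpow_mul hN0.le]
          norm_num
    have h2 := Real.log_le_rpow_div hN0.le (show (0 : ℝ) < 1 / 2 by norm_num)
    have h3 : (N : ℝ) ^ (1 / 2 : ℝ) * (N : ℝ) ^ (1 / 2 : ℝ) = N := by
      rw [← Real.rpow_add hN0]
      norm_num
    refine h1.trans ?_
    rw [← mul_div_assoc, le_div_iff₀ hlog]
    have h4 : 0 ≤ (N : ℝ) ^ (1 / 2 : ℝ) := by positivity
    calc (N : ℝ) ^ (1 / 2 : ℝ) * Real.log N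
        ≤ (N : ℝ) ^ (1 / 2 : ℝ) * ((N : ℝ) ^ (1 / 2 : ℝ) / (1 / 2)) := by gcongr
      _ = 2 * ((N : ℝ) ^ (1 / 2 : ℝ) * (N : ℝ) ^ (1 / 2 : ℝ)) := by ring
      _ = 2 * N := by rw [h3]
  have hRR : (R : ℝ) ≤ (R : ℝ) ^ 6 :=
    le_self_pow₀ (by exact_mod_cast hR) (by norm_num)
  have := card_primes_Ioc_le M N hR
  rw [mul_div_assoc]
  linarith

theorem sum_inv_primes_Ico_le {m N : ℕ} (hm : 2 ≤ m) (hN : 2 ≤ N)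
    (hmN : Real.log m ≤ 3 * Real.log N) :
    ∑ p ∈ (Finset.Ico m (m + N)).filter Nat.Prime, (1 : ℝ) / p ≤
      84 * (N / (m * Real.log m)) := by
  have hm2 : (2 : ℝ) ≤ m := by exact_mod_cast hm
  have hlogm : 0 < Real.log m := Real.log_pos (by linarith)
  have hlogN : 0 < Real.log N := by linarith
  have hI : Finset.Ico m (m + N) = Finset.Ioc (m - 1) (m - 1 + N) := by
    ext k; simp only [Finset.mem_Ico, Finset.mem_Ioc]; omega
  calc _ ≤ ∑ p ∈ (Finset.Ico m (m + N)).filter Nat.Prime, (1 : ℝ) / m := by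
        refine Finset.sum_le_sum fun p hp => ?_
        have : m ≤ p := (Finset.mem_Ico.mp (Finset.mem_filter.mp hp).1).1
        gcongr
    _ = (((Finset.Ico m (m + N)).filter Nat.Prime).card : ℝ) * (1 / m) := by
        rw [Finset.sum_const, nsmul_eq_mul]
    _ ≤ 28 * N / Real.log N * (1 / m) := by
        rw [hI]
        gcongr
        exact card_primes_Ioc_le_div_log (m - 1) hN
    _ ≤ 28 * N / (Real.log m / 3) * (1 / m) := by
        gcongr
        linarith
    _ = _ := by field_simp; norm_num

/-- Mertens' upper bound in short intervals. -/
theorem sum_inv_primes_Icc_le (n : ℕ) {m : ℕ} (hm : 2 ≤ m) (hmn : m ≤ n) :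
    ∑ p ∈ (Finset.Icc m n).filter Nat.Prime, (1 : ℝ) / p ≤
      336 * (Real.log (Real.log n) - Real.log (Real.log m)) + 336 * (m : ℝ) ^ (-2 / 3 : ℝ) := by
  induction hk : n - m using Nat.strong_induction_on generalizing m with
  | _ k ih =>
  have hm2 : (2 : ℝ) ≤ m := by exact_mod_cast hm
  have hm0 : (0 : ℝ) < m := by linarith
  have hlog2 : (1 : ℝ) / 2 ≤ Real.log m := by
    have := Real.log_two_gt_d9
    have := Real.log_le_log (by norm_num) hm2
    linarith
  have hlogm : 0 < Real.log m := by linarith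
  set t : ℝ := (m : ℝ) ^ (1 / 3 : ℝ) with ht
  have ht1 : 1 < t := Real.one_lt_rpow (by linarith) (by norm_num)
  set N : ℕ := ⌈t⌉₊ with hN
  have htN : t ≤ N := Nat.le_ceil t
  have hNt : (N : ℝ) < t + 1 := Nat.ceil_lt_add_one (by linarith)
  have hN2 : 2 ≤ N := by
    have : (1 : ℝ) < N := by linarith
    exact_mod_cast this
  have hNm : N ≤ m := by
    refine Nat.ceil_le.mpr ?_
    calc t ≤ (m : ℝ) ^ (1 : ℝ) := Real.rpow_le_rpow_of_exponent_le (by linarith) (by norm_num)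
      _ = m := Real.rpow_one _
  have hNm' : (N : ℝ) ≤ m := by exact_mod_cast hNm
  have hlogs : Real.log m ≤ 3 * Real.log N := by
    have := Real.log_le_log (by linarith) htN
    rw [ht, Real.log_rpow hm0] at this
    linarith
  have hblock := sum_inv_primes_Ico_le hm hN2 hlogs
  rcases lt_or_ge n (m + N) with hlt | hge
  · have hsub : (Finset.Icc m n).filter Nat.Prime ⊆
        (Finset.Ico m (m + N)).filter Nat.Prime := by
      refine Finset.filter_subset_filter _ fun p hp => ?_
      simp only [Finset.mem_Icc, Finset.mem_Ico] at hp ⊢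
      omega
    have h1 := Finset.sum_le_sum_of_subset_of_nonneg (f := fun p : ℕ => (1 : ℝ) / p) hsub
      fun _ _ _ => by positivity
    have h2 : (N : ℝ) / (m * Real.log m) ≤ 4 * (m : ℝ) ^ (-2 / 3 : ℝ) := by
      have h3 : (m : ℝ) ^ (-2 / 3 : ℝ) * m = t := by
        rw [ht, ← Real.rpow_add_one hm0.ne']
        norm_num
      have h4 : 0 ≤ (m : ℝ) ^ (-2 / 3 : ℝ) := by positivity
      rw [div_le_iff₀ (by positivity)]
      calc (N : ℝ) ≤ 4 * t * (1 / 2) := by linarith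
        _ ≤ 4 * t * Real.log m := by gcongr
        _ = _ := by rw [← h3]; ring
    have h5 : Real.log (Real.log m) ≤ Real.log (Real.log n) :=
      Real.log_le_log hlogm (Real.log_le_log hm0 (by exact_mod_cast hmn))
    linarith
  · have hsplit : (Finset.Icc m n).filter Nat.Prime ⊆
        (Finset.Ico m (m + N)).filter Nat.Prime ∪ (Finset.Icc (m + N) n).filter Nat.Prime := by
      intro p
      simp only [Finset.mem_union, Finset.mem_filter, Finset.mem_Icc, Finset.mem_Ico]
      rintro ⟨⟨h1, h2⟩, hp⟩
      rcases lt_or_ge p (m + N) with h | h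
      · exact Or.inl ⟨⟨h1, h⟩, hp⟩
      · exact Or.inr ⟨⟨h, h2⟩, hp⟩
    have h1 := Finset.sum_le_sum_of_subset_of_nonneg (f := fun p : ℕ => (1 : ℝ) / p) hsplit
      fun _ _ _ => by positivity
    have h2 := Finset.sum_union_inter (f := fun p : ℕ => (1 : ℝ) / p)
      (s₁ := (Finset.Ico m (m + N)).filter Nat.Prime)
      (s₂ := (Finset.Icc (m + N) n).filter Nat.Prime)
    have h3 : 0 ≤ ∑ p ∈ (Finset.Ico m (m + N)).filter Nat.Prime ∩
        (Finset.Icc (m + N) n).filter Nat.Prime, (1 : ℝ) / p :=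
      Finset.sum_nonneg fun _ _ => by positivity
    have h4 := ih (n - (m + N)) (by omega) (by omega : 2 ≤ m + N) hge rfl
    have h5 : ((m + N : ℕ) : ℝ) ^ (-2 / 3 : ℝ) ≤ (m : ℝ) ^ (-2 / 3 : ℝ) :=
      Real.rpow_le_rpow_of_nonpos hm0 (by push_cast; linarith) (by norm_num)
    have hN0 : (0 : ℝ) < N := by linarith
    have hdiff : (N : ℝ) / (m * Real.log m) ≤
        4 * (Real.log (Real.log (m + N : ℕ)) - Real.log (Real.log m)) := by
      push_cast
      set L := Real.log (m + N) with hL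
      have hLm : Real.log m ≤ L := Real.log_le_log hm0 (by linarith)
      have hL0 : 0 < L := by linarith
      have hL2 : L ≤ 2 * Real.log m := by
        have := Real.log_le_log (by positivity) (show (m : ℝ) + N ≤ m * m by nlinarith)
        rw [Real.log_mul hm0.ne' hm0.ne'] at this
        linarith
      have h6 : (N : ℝ) / (2 * m) ≤ L - Real.log m := by
        rw [hL, ← Real.log_div (by positivity) hm0.ne']
        refine le_trans ?_ (Real.one_sub_inv_le_log_of_pos (by positivity))
        have : 1 - (((m : ℝ) + N) / m)⁻¹ = N / (m + N) := by
          field_simp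
          ring
        rw [this]
        gcongr
        linarith
      have h7 : (L - Real.log m) / L ≤ Real.log L - Real.log (Real.log m) := by
        rw [← Real.log_div hL0.ne' hlogm.ne']
        refine le_trans (le_of_eq ?_) (Real.one_sub_inv_le_log_of_pos (by positivity))
        field_simp
      have h8 : (N : ℝ) / (2 * m) / (2 * Real.log m) ≤ (L - Real.log m) / L := by gcongr
      have h9 : (N : ℝ) / (m * Real.log m) = 4 * ((N : ℝ) / (2 * m) / (2 * Real.log m)) := by
        field_simp
        norm_num
      linarith
    linarith

theorem chiD_odd (D : ℕ) [Fact (Nat.Prime D)] (hD : D % 4 = 3) : (chiD D).Odd := by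
  have hnot : ¬ IsSquare (-1 : ZMod D) := by
    rw [FiniteField.isSquare_neg_one_iff, ZMod.card]
    exact fun h => h hD
  have h := quadraticChar_neg_one_iff_not_isSquare.mpr hnot
  simp [DirichletCharacter.Odd, chiD, h]

/-- The trivial zero at `-1` limits the strength of the hypothesis. -/
theorem HypH.le_two_mul_log {c : ℝ} {D : ℕ} [Fact (Nat.Prime D)] (hD : 3 < D)
    (hD4 : D % 4 = 3) (h : HypH c D) : c ≤ 2 * Real.log D := by
  have hzero := (chiD_odd D hD4).LFunction_neg_two_mul_nat_sub_one 0
  have hre := h _ hzero (by simp)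
  have hlog : 0 < Real.log D := Real.log_pos (by exact_mod_cast (by omega : 1 < D))
  simp at hre
  rw [← div_le_iff₀ hlog]
  linarith

theorem one_add_chiDZ_le_two (D : ℕ) [Fact (Nat.Prime D)] (n : ℕ) :
    1 + (chiDZ D n : ℝ) ≤ 2 := by
  have h : chiDZ D n ≤ 1 := by
    rcases quadraticChar_isQuadratic (ZMod D) (n : ZMod D) with h | h | h <;>
      simp [chiDZ, h]
  have : (chiDZ D n : ℝ) ≤ 1 := by exact_mod_cast h
  linarith

open Classical in
theorem upper_bound_sum_lambda_chi0_over_primes :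
    ∃ Kc : ℝ, ∀ (c : ℝ), 0 < c → ∀ (D : ℕ) [Fact (Nat.Prime D)],
      3 < D → D % 4 = 3 → HypH c D →
    ∀ (x θ α₁ α₂ : ℝ), 2 ≤ x → 0 < θ → (D : ℝ) = x ^ θ →
      0 < α₁ → α₁ < α₂ → α₂ < 1 →
    (∑' p : ℕ, if p.Prime ∧ x ^ α₁ ≤ (p : ℝ) ∧ (p : ℝ) ≤ x ^ α₂ then
        (1 + (chiDZ D p : ℝ)) / p else 0) ≤
      Kc * (Real.log (α₂ / α₁) + Real.exp (-c * α₁ / (3 * θ))) := by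
  refine ⟨672, fun c _ D _ hD hD4 hH x θ α₁ α₂ hx hθ hDx hα₁ hα hα₂ => ?_⟩
  have hx0 : 0 < x := by linarith
  have hlogx : 0 < Real.log x := Real.log_pos (by linarith)
  have hP1 : 1 < x ^ α₁ := Real.one_lt_rpow (by linarith) hα₁
  have hα₂0 : 0 < α₂ := hα₁.trans hα
  set m := ⌈x ^ α₁⌉₊ with hm
  set n := ⌊x ^ α₂⌋₊ with hn
  have hPm : x ^ α₁ ≤ m := Nat.le_ceil _
  have hnQ : (n : ℝ) ≤ x ^ α₂ := Nat.floor_le (by positivity)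
  have hm2 : 2 ≤ m := by
    have : (1 : ℝ) < m := by linarith
    exact_mod_cast this
  have hratio : 0 ≤ Real.log (α₂ / α₁) :=
    Real.log_nonneg (by rw [le_div_iff₀ hα₁]; linarith)
  have htsum : (∑' p : ℕ, if p.Prime ∧ x ^ α₁ ≤ (p : ℝ) ∧ (p : ℝ) ≤ x ^ α₂ then
        (1 + (chiDZ D p : ℝ)) / p else 0) ≤
      2 * ∑ p ∈ (Finset.Icc m n).filter Nat.Prime, (1 : ℝ) / p := by
    rw [tsum_eq_sum (s := (Finset.Icc m n).filter Nat.Prime), Finset.mul_sum]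
    · refine Finset.sum_le_sum fun p _ => ?_
      split_ifs
      · rw [mul_one_div]
        gcongr
        exact one_add_chiDZ_le_two D p
      · positivity
    · intro p hp
      refine if_neg fun h => hp ?_
      exact Finset.mem_filter.mpr ⟨Finset.mem_Icc.mpr
        ⟨Nat.ceil_le.mpr h.2.1, Nat.le_floor h.2.2⟩, h.1⟩
  refine htsum.trans ?_
  rcases lt_or_ge n m with hlt | hmn
  · rw [Finset.Icc_eq_empty_of_lt hlt]
    simp
    positivity
  have hsum := sum_inv_primes_Icc_le n hm2 hmn
  have hm0 : (0 : ℝ) < m := by linarith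
  have hlogn : Real.log (Real.log n) ≤ Real.log α₂ + Real.log (Real.log x) := by
    rw [← Real.log_mul hα₂0.ne' hlogx.ne', ← Real.log_rpow hx0]
    have hn1 : (1 : ℝ) < n := by exact_mod_cast (by omega : 1 < n)
    exact Real.log_le_log (Real.log_pos hn1) (Real.log_le_log (by linarith) hnQ)
  have hlogm : Real.log α₁ + Real.log (Real.log x) ≤ Real.log (Real.log m) := by
    rw [← Real.log_mul hα₁.ne' hlogx.ne', ← Real.log_rpow hx0]
    exact Real.log_le_log (Real.log_pos hP1) (Real.log_le_log (by linarith) hPm)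
  have hexp : (m : ℝ) ^ (-2 / 3 : ℝ) ≤ Real.exp (-c * α₁ / (3 * θ)) := by
    refine (Real.rpow_le_rpow_of_nonpos (by linarith) hPm (by norm_num)).trans ?_
    rw [← Real.rpow_mul hx0.le, Real.rpow_def_of_pos hx0]
    refine Real.exp_le_exp.mpr ?_
    have hc := hH.le_two_mul_log hD hD4
    rw [hDx, Real.log_rpow hx0] at hc
    rw [le_div_iff₀ (by positivity)]
    nlinarith
  rw [Real.log_div hα₂0.ne' hα₁.ne']
  linarith
end
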